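/- arXiv:1405.5400 — 2 statements merged into one kernel-verified Lean document; each statement's English description precedes it below -/
import Mathlib

section
/- Let G be a group generated by a finite set A, with word metric d_A. Then G is virtually free if and only if there exists μ ≥ 0 such that for every discrete triangle in G, i.e., every closed cycle of three discrete paths γ₀, γ₁, γ₂ (the endpoint of each γᵢ equal to the starting point of γᵢ₊₁, indices modulo 3), there exist vertices u₀ of γ₀, u₁ of γ₁, u₂ of γ₂ with d_A(uᵢ,uⱼ) ≤ μ for all i,j. -/
/-- The word metric associated with a generating set `A` of a group `G`:
`wordDist A g h` is the least `n` such that `g⁻¹h` is a product of `n` elements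
of `A ∪ A⁻¹`. -/
noncomputable def wordDist {G : Type*} [Group G] (A : Set G) (g h : G) : ℕ :=
  sInf { n : ℕ | ∃ l : List G, l.length = n ∧ (∀ x ∈ l, x ∈ A ∪ A⁻¹) ∧ l.prod = g⁻¹ * h }

/-- A group is virtually free if it has a free subgroup of finite index. -/
def VirtuallyFree (G : Type*) [Group G] : Prop :=
  ∃ H : Subgroup G, H.FiniteIndex ∧ IsFreeGroup H
/-- `γ 0, γ 1, …, γ m` is a discrete geodesic for the word metric of `A`:
`d_A(γ i, γ j) = |i − j|` for all `i, j ≤ m`. -/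
def IsDiscGeodesic {G : Type*} [Group G] (A : Set G) (γ : ℕ → G) (m : ℕ) : Prop :=
  ∀ i ≤ m, ∀ j ≤ m, (wordDist A (γ i) (γ j) : ℤ) = |(i : ℤ) - (j : ℤ)|

/-- `γ 0, γ 1, …, γ m` is a discrete path for the word metric of `A`:
consecutive vertices are at distance at most `1`. -/
def IsDiscPath {G : Type*} [Group G] (A : Set G) (γ : ℕ → G) (m : ℕ) : Prop :=
  ∀ i < m, wordDist A (γ i) (γ (i + 1)) ≤ 1

section Cuts

variable {V : Type*}

/-- The ordered edges of the relation `E` leaving the set `C`. -/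
def edgeBoundary (E : V → V → Prop) (C : Set V) : Set (V × V) :=
  {e | e.1 ∈ C ∧ e.2 ∉ C ∧ E e.1 e.2}

/-- A set is connected when it has no nontrivial splitting without edges between the parts. -/
def ConnectedSet (E : V → V → Prop) (C : Set V) : Prop :=
  ∀ X ⊆ C, (∀ a ∈ X, ∀ b ∈ C \ X, ¬ E a b) → X = ∅ ∨ X = C

/-- Two sets cross when all four corners are nonempty. -/
def Cross (C D : Set V) : Prop :=
  (C ∩ D).Nonempty ∧ (C ∩ Dᶜ).Nonempty ∧ (Cᶜ ∩ D).Nonempty ∧ (Cᶜ ∩ Dᶜ).Nonempty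

theorem Cross.symm {C D : Set V} (h : Cross C D) : Cross D C := by
  obtain ⟨h1, h2, h3, h4⟩ := h
  refine ⟨?_, ?_, ?_, ?_⟩ <;> rw [Set.inter_comm] <;> assumption

theorem Cross.compl_right {C D : Set V} (h : Cross C D) : Cross C Dᶜ := by
  obtain ⟨h1, h2, h3, h4⟩ := h
  exact ⟨h2, by rwa [compl_compl], h4, by rwa [compl_compl]⟩

theorem cross_compl_right {C D : Set V} : Cross C Dᶜ ↔ Cross C D :=
  ⟨fun h => by simpa using h.compl_right, Cross.compl_right⟩

theorem Cross.compl_left {C D : Set V} (h : Cross C D) : Cross Cᶜ D :=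
  h.symm.compl_right.symm

theorem not_cross_iff {C D : Set V} :
    ¬ Cross C D ↔ C ∩ D = ∅ ∨ C ⊆ D ∨ D ⊆ C ∨ C ∪ D = Set.univ := by
  unfold Cross
  rw [not_and_or, not_and_or, not_and_or, Set.not_nonempty_iff_eq_empty,
    Set.not_nonempty_iff_eq_empty, Set.not_nonempty_iff_eq_empty, Set.not_nonempty_iff_eq_empty,
    ← Set.sdiff_eq, Set.sdiff_eq_empty, Set.inter_comm Cᶜ D, ← Set.sdiff_eq, Set.sdiff_eq_empty,
    ← Set.compl_union, Set.compl_empty_iff]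

variable {E : V → V → Prop}

theorem encard_edgeBoundary_compl (hE : ∀ a b, E a b → E b a) (C : Set V) :
    (edgeBoundary E Cᶜ).encard = (edgeBoundary E C).encard := by
  have : edgeBoundary E Cᶜ = Prod.swap '' edgeBoundary E C := by
    ext ⟨a, b⟩
    simp only [edgeBoundary, Set.mem_ofPred_eq, Set.mem_compl_iff, not_not, Set.mem_image,
      Prod.exists, Prod.swap_prod_mk, Prod.mk.injEq]
    constructor
    · rintro ⟨h1, h2, h3⟩
      exact ⟨b, a, ⟨h2, h1, hE _ _ h3⟩, rfl, rfl⟩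
    · rintro ⟨x, y, ⟨h1, h2, h3⟩, rfl, rfl⟩
      exact ⟨h2, h1, hE _ _ h3⟩
  rw [this, Prod.swap_injective.encard_image]

theorem encard_edgeBoundary_submodular (C D : Set V) :
    (edgeBoundary E (C ∩ D)).encard + (edgeBoundary E (C ∪ D)).encard ≤
      (edgeBoundary E C).encard + (edgeBoundary E D).encard := by
  rw [← Set.encard_union_add_encard_inter (edgeBoundary E (C ∩ D)),
    ← Set.encard_union_add_encard_inter (edgeBoundary E C)]
  apply add_le_add <;> apply Set.encard_le_encard <;> rintro ⟨a, b⟩ <;>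
    simp only [edgeBoundary, Set.mem_union, Set.mem_inter_iff, Set.mem_ofPred_eq] <;> tauto

theorem edgeBoundary_nonempty (hV : ConnectedSet E Set.univ) {C : Set V} (h0 : C ≠ ∅)
    (h1 : C ≠ Set.univ) : (edgeBoundary E C).Nonempty := by
  by_contra h
  rcases hV C (Set.subset_univ _) (fun a ha b hb hab => h ⟨(a, b), ha, hb.2, hab⟩) with h | h
  exacts [h0 h, h1 h]

theorem connectedSet_of_minimal (hE : ∀ a b, E a b → E b a) (hV : ConnectedSet E Set.univ)
    {C : Set V} (hC : C ≠ Set.univ) (hfin : (edgeBoundary E C).Finite)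
    (hmin : ∀ X ⊆ C, (∀ a ∈ X, ∀ b ∈ C \ X, ¬ E a b) →
      (edgeBoundary E C).encard ≤ (edgeBoundary E X).encard ∨
      (edgeBoundary E C).encard ≤ (edgeBoundary E (C \ X)).encard) :
    ConnectedSet E C := by
  have key : ∀ X ⊆ C, (∀ a ∈ X, ∀ b ∈ C \ X, ¬ E a b) →
      (edgeBoundary E C).encard ≤ (edgeBoundary E X).encard → X = C := by
    intro X hX hXe hle
    have hsub : edgeBoundary E X ⊆ edgeBoundary E C := by
      rintro ⟨a, b⟩ ⟨h1, h2, h3⟩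
      exact ⟨hX h1, fun hb => hXe a h1 b ⟨hb, h2⟩ h3, h3⟩
    have heq : edgeBoundary E X = edgeBoundary E C :=
      (hfin.subset hsub).eq_of_subset_of_encard_le hsub hle
    have hemp : ¬ (edgeBoundary E (C \ X)).Nonempty := by
      rintro ⟨⟨a, b⟩, h1, h2, h3⟩
      by_cases hb : b ∈ C
      · have hbX : b ∈ X := by by_contra h; exact h2 ⟨hb, h⟩
        exact hXe b hbX a h1 (hE _ _ h3)
      · have : (a, b) ∈ edgeBoundary E X := by rw [heq]; exact ⟨h1.1, hb, h3⟩
        exact h1.2 this.1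
    have h0 : C \ X = ∅ := by
      by_contra h0
      refine hemp (edgeBoundary_nonempty hV h0 fun h => hC ?_)
      rw [Set.eq_univ_iff_forall] at h ⊢
      exact fun x => (h x).1
    exact hX.antisymm (Set.sdiff_eq_empty.1 h0)
  intro X hX hXe
  rcases hmin X hX hXe with h | h
  · exact Or.inr (key X hX hXe h)
  · left
    have := key (C \ X) Set.sdiff_subset (fun a ha b hb hab => by
      have hbX : b ∈ X := by by_contra h; exact hb.2 ⟨hb.1, h⟩
      exact hXe b hbX a ha (hE _ _ hab)) h
    ext x
    simp only [Set.mem_empty_iff_false, iff_false]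
    intro hx
    have hx' := hX hx
    rw [← this] at hx'
    exact hx'.2 hx

/-- The connected cuts with at most `k` boundary edges. -/
def connCuts (E : V → V → Prop) (k : ℕ) : Set (Set V) :=
  {C | ConnectedSet E C ∧ ConnectedSet E Cᶜ ∧ (edgeBoundary E C).encard ≤ k}

theorem reflTransGen_of_connectedSet_univ (hV : ConnectedSet E Set.univ) (x y : V) :
    Relation.ReflTransGen E x y := by
  rcases hV {y | Relation.ReflTransGen E x y} (Set.subset_univ _)
    (fun a ha b hb hab => hb.2 (Relation.ReflTransGen.tail ha hab)) with h | h
  · exact absurd (show x ∈ {y | Relation.ReflTransGen E x y} from .refl) (by rw [h]; simp)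
  · exact (Set.eq_univ_iff_forall.1 h y)

/-- Only finitely many connected cuts of bounded size separate two given points. -/
theorem finite_connCuts_separating (k : ℕ) : ∀ {E : V → V → Prop}, (∀ a b, E a b → E b a) →
    ConnectedSet E Set.univ → ∀ x y : V, {C | C ∈ connCuts E k ∧ x ∈ C ∧ y ∉ C}.Finite := by
  induction k with
  | zero =>
    intro E hE hV x y
    convert Set.finite_empty
    rw [Set.eq_empty_iff_forall_notMem]
    rintro C ⟨⟨_, _, h⟩, hx, hy⟩
    have := edgeBoundary_nonempty hV (C := C) (fun h => by simp [h] at hx)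
      (fun h => by simp [h] at hy)
    rw [← Set.encard_pos] at this
    simp only [Nat.cast_zero, nonpos_iff_eq_zero] at h
    simp [h] at this
  | succ k ih =>
    intro E hE hV
    have hedge : ∀ x y, E x y → {C | C ∈ connCuts E (k + 1) ∧ x ∈ C ∧ y ∉ C}.Finite := by
      intro x y hxy
      let E' : V → V → Prop := fun a b => E a b ∧ ¬ (a = x ∧ b = y) ∧ ¬ (a = y ∧ b = x)
      have hE' : ∀ a b, E' a b → E' b a := fun a b h => ⟨hE _ _ h.1, by tauto, by tauto⟩
      have hconn : ∀ C : Set V, (x ∉ C ∨ y ∉ C) → ConnectedSet E C → ConnectedSet E' C := by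
        intro C hxyC hC X hX hXe
        refine hC X hX fun a ha b hb hab => hXe a ha b hb ⟨hab, ?_, ?_⟩
        · rintro ⟨rfl, rfl⟩
          exact hxyC.elim (· (hX ha)) (· hb.1)
        · rintro ⟨rfl, rfl⟩
          exact hxyC.elim (· hb.1) (· (hX ha))
      by_cases hV' : ConnectedSet E' Set.univ
      · refine (ih hE' hV' x y).subset ?_
        rintro C ⟨⟨h1, h2, h3⟩, hx, hy⟩
        refine ⟨⟨hconn C (Or.inr hy) h1, hconn Cᶜ (Or.inl (by simpa using hx)) h2, ?_⟩, hx, hy⟩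
        have hsub : insert (x, y) (edgeBoundary E' C) ⊆ edgeBoundary E C := by
          rw [Set.insert_subset_iff]
          exact ⟨⟨hx, hy, hxy⟩, fun e he => ⟨he.1, he.2.1, he.2.2.1⟩⟩
        have hle := (Set.encard_le_encard hsub).trans h3
        rw [Set.encard_insert_of_notMem (fun h => h.2.2.2.1 ⟨rfl, rfl⟩), Nat.cast_add,
          Nat.cast_one] at hle
        exact (ENat.add_le_add_iff_right ENat.one_ne_top).1 hle
      · simp only [ConnectedSet, not_forall] at hV'
        obtain ⟨X, -, hXe, hX⟩ := hV'
        rw [not_or] at hX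
        refine (Set.toFinite {X, Xᶜ}).subset ?_
        rintro C ⟨⟨h1, h2, -⟩, hx, hy⟩
        have h1' := hconn C (Or.inr hy) h1
        have h2' := hconn Cᶜ (Or.inl (by simpa using hx)) h2
        have e1 := h1' (C ∩ X) Set.inter_subset_left (fun a ha b hb =>
          hXe a ha.2 b ⟨Set.mem_univ _, fun h => hb.2 ⟨hb.1, h⟩⟩)
        have e2 := h2' (Cᶜ ∩ X) Set.inter_subset_left (fun a ha b hb =>
          hXe a ha.2 b ⟨Set.mem_univ _, fun h => hb.2 ⟨hb.1, h⟩⟩)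
        have hdec : C ∩ X ∪ Cᶜ ∩ X = X := by rw [← Set.union_inter_distrib_right]; simp
        simp only [Set.mem_insert_iff, Set.mem_singleton_iff]
        rcases e1 with e1 | e1 <;> rcases e2 with e2 | e2 <;> rw [e1, e2] at hdec
        · simp at hdec; exact absurd hdec.symm hX.1
        · right; rw [← hdec]; simp
        · left; rw [← hdec]; simp
        · simp at hdec; exact absurd hdec.symm hX.2
    intro x y
    induction reflTransGen_of_connectedSet_univ hV x y with
    | refl => convert Set.finite_empty; ext C; simp
    | @tail b c _ hbc ih' =>
      refine (ih'.union (hedge b c hbc)).subset ?_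
      rintro C ⟨h, hx, hc⟩
      by_cases hb : b ∈ C
      · exact Or.inr ⟨h, hb, hc⟩
      · exact Or.inl ⟨h, hx, hb⟩

theorem exists_edgeBoundary_subset_of_cross {C D : Set V}
    (hD : ConnectedSet E D) (h1 : (D ∩ C).Nonempty) (h2 : (D ∩ Cᶜ).Nonempty) :
    ∃ e ∈ edgeBoundary E C, e.1 ∈ D ∧ e.2 ∈ D := by
  by_contra hcon
  rcases hD (D ∩ C) Set.inter_subset_left (fun a ha b hb hab => hcon ⟨(a, b),
    ⟨ha.2, fun h => hb.2 ⟨hb.1, h⟩, hab⟩, ha.1, hb.1⟩) with h | h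
  · simp [h] at h1
  · obtain ⟨x, hx, hx'⟩ := h2
    rw [← h] at hx
    exact hx' hx.2

theorem finite_cross_connCuts (hE : ∀ a b, E a b → E b a) (hV : ConnectedSet E Set.univ) {k : ℕ}
    {C : Set V} (hC : (edgeBoundary E C).Finite) :
    {D | D ∈ connCuts E k ∧ Cross D C}.Finite := by
  refine ((hC.prod hC).biUnion fun e _ =>
    finite_connCuts_separating k hE hV e.1.1 e.2.1).subset ?_
  rintro D ⟨hD, h⟩
  obtain ⟨e, he, he', -⟩ := exists_edgeBoundary_subset_of_cross hD.1 h.1 h.2.1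
  obtain ⟨e2, he2, he2', -⟩ := exists_edgeBoundary_subset_of_cross hD.2.1 h.2.2.1 h.2.2.2
  simp only [Set.mem_iUnion]
  exact ⟨(e, e2), ⟨he, he2⟩, hD, he', he2'⟩

end Cuts

section OptimalCuts

variable {V : Type*}

/-- `C` is a cut of minimal size, at most `K`, separating the ultrafilters `p` and `q`. -/
def IsMinCut (E : V → V → Prop) (K : ℕ) (p q : Ultrafilter V) (C : Set V) : Prop :=
  C ∈ p ∧ C ∉ q ∧ (edgeBoundary E C).encard ≤ K ∧
    ∀ D ∈ p, D ∉ q → (edgeBoundary E C).encard ≤ (edgeBoundary E D).encard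

/-- The cuts that are minimal for some pair of ultrafilters. -/
def minCuts (E : V → V → Prop) (K : ℕ) : Set (Set V) :=
  {C | ∃ p q, IsMinCut E K p q C}

/-- The number of minimal cuts crossing `C`. -/
noncomputable def crossNum (E : V → V → Prop) (K : ℕ) (C : Set V) : ℕ :=
  {D | D ∈ minCuts E K ∧ Cross D C}.ncard

/-- `C` is a minimal cut separating `p` and `q` that is crossed by as few minimal cuts as
possible. -/
def IsOptCut (E : V → V → Prop) (K : ℕ) (p q : Ultrafilter V) (C : Set V) : Prop :=
  IsMinCut E K p q C ∧ ∀ D, IsMinCut E K p q D → crossNum E K C ≤ crossNum E K D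

/-- The cuts that are optimal for some pair of ultrafilters. -/
def optCuts (E : V → V → Prop) (K : ℕ) : Set (Set V) :=
  {C | ∃ p q, IsOptCut E K p q C}

variable {E : V → V → Prop} {K : ℕ} {p q r s : Ultrafilter V} {C D : Set V}

theorem optCuts_subset_minCuts : optCuts E K ⊆ minCuts E K :=
  fun _ ⟨p, q, h⟩ => ⟨p, q, h.1⟩

theorem IsMinCut.compl (hE : ∀ a b, E a b → E b a) (h : IsMinCut E K p q C) :
    IsMinCut E K q p Cᶜ := by
  obtain ⟨h1, h2, h3, h4⟩ := h
  refine ⟨Ultrafilter.compl_mem_iff_notMem.2 h2, fun h => Ultrafilter.compl_mem_iff_notMem.1 h h1,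
    by rwa [encard_edgeBoundary_compl hE], fun D hq hp => ?_⟩
  rw [encard_edgeBoundary_compl hE, ← encard_edgeBoundary_compl hE D]
  exact h4 _ (Ultrafilter.compl_mem_iff_notMem.2 hp)
    fun h => Ultrafilter.compl_mem_iff_notMem.1 h hq

theorem crossNum_compl : crossNum E K Cᶜ = crossNum E K C := by
  simp only [crossNum, cross_compl_right]

theorem IsOptCut.compl (hE : ∀ a b, E a b → E b a) (h : IsOptCut E K p q C) :
    IsOptCut E K q p Cᶜ := by
  refine ⟨h.1.compl hE, fun D hD => ?_⟩
  rw [crossNum_compl, ← crossNum_compl (C := D)]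
  exact h.2 _ (hD.compl hE)

theorem compl_mem_optCuts (hE : ∀ a b, E a b → E b a) (h : C ∈ optCuts E K) :
    Cᶜ ∈ optCuts E K := by
  obtain ⟨p, q, h⟩ := h
  exact ⟨q, p, h.compl hE⟩

theorem IsMinCut.finite (h : IsMinCut E K p q C) : (edgeBoundary E C).Finite :=
  Set.finite_of_encard_le_coe h.2.2.1

theorem IsMinCut.connectedSet (hE : ∀ a b, E a b → E b a) (hV : ConnectedSet E Set.univ)
    (h : IsMinCut E K p q C) : ConnectedSet E C := by
  refine connectedSet_of_minimal hE hV (fun hC => h.2.1 (by rw [hC]; exact Filter.univ_mem))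
    h.finite fun X hX _ => ?_
  have hq : ∀ Y ⊆ C, Y ∉ q := fun Y hY hYq => h.2.1 (Filter.mem_of_superset hYq hY)
  by_cases hp : X ∈ p
  · exact Or.inl (h.2.2.2 X hp (hq X hX))
  · refine Or.inr (h.2.2.2 _ ?_ (hq _ Set.sdiff_subset))
    exact Filter.inter_mem h.1 (Ultrafilter.compl_mem_iff_notMem.2 hp)

theorem minCuts_subset_connCuts (hE : ∀ a b, E a b → E b a) (hV : ConnectedSet E Set.univ) :
    minCuts E K ⊆ connCuts E K := by
  rintro C ⟨p, q, h⟩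
  exact ⟨h.connectedSet hE hV, (h.compl hE).connectedSet hE hV, h.2.2.1⟩

theorem crossNum_add_lt (hE : ∀ a b, E a b → E b a) (hV : ConnectedSet E Set.univ)
    (hC : C ∈ minCuts E K) (hD : D ∈ minCuts E K) (hCD : Cross C D)
    (hI : C ∩ D ∈ minCuts E K) (hU : C ∪ D ∈ minCuts E K) :
    crossNum E K (C ∩ D) + crossNum E K (C ∪ D) < crossNum E K C + crossNum E K D := by
  have hfin : ∀ X ∈ minCuts E K, {F | F ∈ minCuts E K ∧ Cross F X}.Finite := by
    intro X hX
    obtain ⟨p, q, h⟩ := hX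
    exact (finite_cross_connCuts hE hV (k := K) h.finite).subset
      fun F hF => ⟨minCuts_subset_connCuts hE hV hF.1, hF.2⟩
  unfold crossNum
  rw [← Set.ncard_union_add_ncard_inter _ _ (hfin _ hI) (hfin _ hU),
    ← Set.ncard_union_add_ncard_inter _ _ (hfin _ hC) (hfin _ hD)]
  apply add_lt_add_of_lt_of_le
  · apply Set.ncard_lt_ncard _ ((hfin _ hC).union (hfin _ hD))
    rw [Set.ssubset_iff_of_subset]
    · refine ⟨C, Or.inr ⟨hC, hCD⟩, ?_⟩
      rintro (⟨-, h⟩ | ⟨-, h⟩)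
      · obtain ⟨x, hx, hx'⟩ := h.2.2.1
        exact hx hx'.1
      · obtain ⟨x, hx, hx'⟩ := h.2.1
        exact hx' (Or.inl hx)
    · rintro F (⟨hF, ⟨a, ha⟩, ⟨b, hb⟩, ⟨c, hc⟩, ⟨d, hd⟩⟩ | ⟨hF, ⟨a, ha⟩, ⟨b, hb⟩, ⟨c, hc⟩, ⟨d, hd⟩⟩)
      all_goals
        by_contra hcon
        simp only [Set.mem_union, Set.mem_ofPred_eq, hF, true_and, not_or, not_cross_iff] at hcon
        obtain ⟨x1, hx1⟩ := hCD.1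
        obtain ⟨x2, hx2⟩ := hCD.2.1
        obtain ⟨x3, hx3⟩ := hCD.2.2.1
        obtain ⟨x4, hx4⟩ := hCD.2.2.2
        simp only [Set.eq_univ_iff_forall, Set.eq_empty_iff_forall_notMem, Set.subset_def,
          Set.mem_inter_iff, Set.mem_union, Set.mem_compl_iff] at *
        obtain ⟨h1, h2⟩ := hcon
        rcases h1 with h1 | h1 | h1 | h1 <;> rcases h2 with h2 | h2 | h2 | h2 <;> grind
  · apply Set.ncard_le_ncard _ ((hfin _ hC).inter_of_left _)
    rintro F ⟨⟨hF, ⟨a, ha⟩, ⟨b, hb⟩, ⟨c, hc⟩, ⟨d, hd⟩⟩,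
      ⟨-, ⟨a', ha'⟩, ⟨b', hb'⟩, ⟨c', hc'⟩, ⟨d', hd'⟩⟩⟩
    simp only [Set.mem_inter_iff, Set.mem_union, Set.mem_compl_iff, not_or] at *
    refine ⟨⟨hF, ⟨a, ?_⟩, ⟨b', ?_⟩, ⟨c, ?_⟩, ⟨d', ?_⟩⟩,
      ⟨hF, ⟨a, ?_⟩, ⟨b', ?_⟩, ⟨c, ?_⟩, ⟨d', ?_⟩⟩⟩ <;>
      simp only [Set.mem_inter_iff, Set.mem_compl_iff] <;> tauto

theorem encard_corners (hC : (edgeBoundary E C).encard ≤ K)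
    (hD : (edgeBoundary E D).encard ≤ K) :
    ∃ c d i u : ℕ, (edgeBoundary E C).encard = c ∧ (edgeBoundary E D).encard = d ∧
      (edgeBoundary E (C ∩ D)).encard = i ∧ (edgeBoundary E (C ∪ D)).encard = u ∧
      i + u ≤ c + d := by
  have hsub := encard_edgeBoundary_submodular (E := E) C D
  obtain ⟨c, hc⟩ := ENat.ne_top_iff_exists.1 (ne_top_of_le_ne_top (ENat.natCast_ne_top K) hC)
  obtain ⟨d, hd⟩ := ENat.ne_top_iff_exists.1 (ne_top_of_le_ne_top (ENat.natCast_ne_top K) hD)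
  rw [← hc, ← hd, ← Nat.cast_add] at hsub
  have hi := ne_top_of_le_ne_top (ENat.natCast_ne_top _) (le_self_add.trans hsub)
  have hu := ne_top_of_le_ne_top (ENat.natCast_ne_top _) (le_add_self.trans hsub)
  obtain ⟨i, hi⟩ := ENat.ne_top_iff_exists.1 hi
  obtain ⟨u, hu⟩ := ENat.ne_top_iff_exists.1 hu
  refine ⟨c, d, i, u, hc.symm, hd.symm, hi.symm, hu.symm, ?_⟩
  rw [← hi, ← hu] at hsub
  exact_mod_cast hsub

theorem IsOptCut.not_cross_aux (hE : ∀ a b, E a b → E b a)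
    (hV : ConnectedSet E Set.univ) (hC : IsOptCut E K p q C) (hD : IsOptCut E K r s D)
    (h : Cross C D) (hDp : D ∈ p) (hCs : C ∉ s) : False := by
  have hIp : C ∩ D ∈ p := Filter.inter_mem hC.1.1 hDp
  have hIq : C ∩ D ∉ q := fun h => hC.1.2.1 (Filter.mem_of_superset h Set.inter_subset_left)
  have hUr : C ∪ D ∈ r := Filter.mem_of_superset hD.1.1 Set.subset_union_right
  have hUs : C ∪ D ∉ s := fun h => (Ultrafilter.union_mem_iff.1 h).elim hCs hD.1.2.1
  have e1 := hC.1.2.2.2 _ hIp hIq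
  have e2 := hD.1.2.2.2 _ hUr hUs
  have hCK := hC.1.2.2.1
  have hDK := hD.1.2.2.1
  obtain ⟨c, d, i, u, hc, hd, hi, hu, hle⟩ := encard_corners hCK hDK
  rw [hc, hi, Nat.cast_le] at e1
  rw [hd, hu, Nat.cast_le] at e2
  rw [hc] at hCK
  rw [hd] at hDK
  have hic : i = c := by omega
  have hud : u = d := by omega
  subst hic hud
  have hI : IsMinCut E K p q (C ∩ D) := ⟨hIp, hIq, by rwa [hi], fun F hp hq => by
    rw [hi, ← hc]; exact hC.1.2.2.2 F hp hq⟩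
  have hU : IsMinCut E K r s (C ∪ D) := ⟨hUr, hUs, by rwa [hu], fun F hp hq => by
    rw [hu, ← hd]; exact hD.1.2.2.2 F hp hq⟩
  have := crossNum_add_lt hE hV ⟨p, q, hC.1⟩ ⟨r, s, hD.1⟩ h ⟨p, q, hI⟩ ⟨r, s, hU⟩
  have := hC.2 _ hI
  have := hD.2 _ hU
  omega

theorem IsOptCut.not_cross_aux' (hE : ∀ a b, E a b → E b a)
    (hV : ConnectedSet E Set.univ) (hC : IsOptCut E K p q C) (hD : IsOptCut E K r s D)
    (h : Cross C D) (hDp : D ∈ p) (hDq : D ∉ q) (hCs : C ∈ s) (hCr : C ∉ r) : False := by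
  have hIp : C ∩ D ∈ p := Filter.inter_mem hC.1.1 hDp
  have hIq : C ∩ D ∉ q := fun h => hC.1.2.1 (Filter.mem_of_superset h Set.inter_subset_left)
  have hUp : C ∪ D ∈ p := Filter.mem_of_superset hDp Set.subset_union_right
  have hUq : C ∪ D ∉ q := fun h => (Ultrafilter.union_mem_iff.1 h).elim hC.1.2.1 hDq
  have e1 := hC.1.2.2.2 _ hIp hIq
  have e2 := hC.1.2.2.2 _ hUp hUq
  have e3 := hC.1.2.2.2 _ hDp hDq
  have hCr' : Cᶜ ∈ r := Ultrafilter.compl_mem_iff_notMem.2 hCr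
  have hCs' : Cᶜ ∉ s := fun h => Ultrafilter.compl_mem_iff_notMem.1 h hCs
  have e4 := hD.1.2.2.2 _ hCr' hCs'
  have hCK := hC.1.2.2.1
  have hDK := hD.1.2.2.1
  obtain ⟨c, d, i, u, hc, hd, hi, hu, hle⟩ := encard_corners hCK hDK
  rw [hc, hi, Nat.cast_le] at e1
  rw [hc, hu, Nat.cast_le] at e2
  rw [hc, hd, Nat.cast_le] at e3
  rw [encard_edgeBoundary_compl hE, hc, hd, Nat.cast_le] at e4
  rw [hc] at hCK
  have hdc : d = c := by omega
  have hic : i = c := by omega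
  have huc : u = c := by omega
  subst hdc hic huc
  have hI : IsMinCut E K p q (C ∩ D) := ⟨hIp, hIq, by rwa [hi], fun F hp hq => by
    rw [hi, ← hc]; exact hC.1.2.2.2 F hp hq⟩
  have hU : IsMinCut E K p q (C ∪ D) := ⟨hUp, hUq, by rwa [hu], fun F hp hq => by
    rw [hu, ← hc]; exact hC.1.2.2.2 F hp hq⟩
  have hC' : IsMinCut E K r s Cᶜ := ⟨hCr', hCs', by rwa [encard_edgeBoundary_compl hE, hc],
    fun F hp hq => by
      rw [encard_edgeBoundary_compl hE, hc, ← hd]; exact hD.1.2.2.2 F hp hq⟩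
  have := crossNum_add_lt hE hV ⟨p, q, hC.1⟩ ⟨r, s, hD.1⟩ h ⟨p, q, hI⟩ ⟨p, q, hU⟩
  have := hC.2 _ hI
  have := hC.2 _ hU
  have := hD.2 _ hC'
  rw [crossNum_compl] at this
  omega

/-- Optimal cuts are pairwise nested. -/
theorem not_cross_of_mem_optCuts (hE : ∀ a b, E a b → E b a)
    (hV : ConnectedSet E Set.univ) (hC : C ∈ optCuts E K) (hD : D ∈ optCuts E K) :
    ¬ Cross C D := by
  intro h
  obtain ⟨p, q, hC⟩ := hC
  obtain ⟨r, s, hD⟩ := hD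
  have mem : ∀ {t : Ultrafilter V} {X : Set V}, X ∉ t → Xᶜ ∈ t :=
    Ultrafilter.compl_mem_iff_notMem.2
  have nmem : ∀ {t : Ultrafilter V} {X : Set V}, X ∈ t → Xᶜ ∉ t :=
    fun h h' => Ultrafilter.compl_mem_iff_notMem.1 h' h
  have k1 : ¬ (D ∈ p ∧ C ∉ s) := fun a => hC.not_cross_aux hE hV hD h a.1 a.2
  have k2 : ¬ (D ∉ p ∧ C ∉ r) := fun a =>
    hC.not_cross_aux hE hV (hD.compl hE) h.compl_right (mem a.1) a.2
  have k3 : ¬ (D ∈ q ∧ C ∈ s) := fun a =>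
    (hC.compl hE).not_cross_aux hE hV hD h.compl_left a.1 (nmem a.2)
  have k4 : ¬ (D ∉ q ∧ C ∈ r) := fun a =>
    (hC.compl hE).not_cross_aux hE hV (hD.compl hE) h.compl_left.compl_right (mem a.1) (nmem a.2)
  have k5 : ¬ (D ∈ p ∧ D ∉ q ∧ C ∈ s ∧ C ∉ r) := fun a =>
    hC.not_cross_aux' hE hV hD h a.1 a.2.1 a.2.2.1 a.2.2.2
  have k6 : ¬ (D ∉ p ∧ D ∈ q ∧ C ∈ r ∧ C ∉ s) := fun a =>
    hC.not_cross_aux' hE hV (hD.compl hE) h.compl_right (mem a.1) (nmem a.2.1) a.2.2.1 a.2.2.2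
  tauto

theorem exists_isOptCut {C : Set V} (hK : (edgeBoundary E C).encard ≤ K) (hp : C ∈ p)
    (hq : C ∉ q) : ∃ D, IsOptCut E K p q D := by
  have hmin : ∃ D, IsMinCut E K p q D := by
    obtain ⟨D, hD, hDmin⟩ := exists_minimalFor_of_wellFoundedLT (fun D : Set V => D ∈ p ∧ D ∉ q)
      (fun D => (edgeBoundary E D).encard) ⟨C, hp, hq⟩
    have hle : ∀ F ∈ p, F ∉ q → (edgeBoundary E D).encard ≤ (edgeBoundary E F).encard :=
      fun F hFp hFq => (le_total _ _).elim id fun h => hDmin ⟨hFp, hFq⟩ h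
    exact ⟨D, hD.1, hD.2, (hle C hp hq).trans hK, hle⟩
  obtain ⟨D, hD, hDmin⟩ := exists_minimalFor_of_wellFoundedLT (fun D => IsMinCut E K p q D)
    (crossNum E K) hmin
  exact ⟨D, hD, fun F hF => (le_total _ _).elim id fun h => hDmin hF h⟩

end OptimalCuts

section GroupCuts

open Pointwise

variable {G : Type*} [Group G]

/-- Adjacency in the Cayley graph of the generating set `A`. -/
def cayleyAdj (A : Set G) (a b : G) : Prop := a⁻¹ * b ∈ A ∪ A⁻¹

theorem cayleyAdj_symm (A : Set G) (a b : G) (h : cayleyAdj A a b) : cayleyAdj A b a := by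
  unfold cayleyAdj at *
  have : b⁻¹ * a = (a⁻¹ * b)⁻¹ := by group
  rw [this]
  rcases h with h | h
  · exact Or.inr (by simpa using h)
  · exact Or.inl (by simpa using h)

theorem cayleyAdj_mul_left (A : Set G) (g a b : G) :
    cayleyAdj A (g * a) (g * b) ↔ cayleyAdj A a b := by
  unfold cayleyAdj
  rw [mul_inv_rev, mul_assoc, inv_mul_cancel_left]

theorem connectedSet_cayleyAdj {A : Set G} (hgen : Subgroup.closure A = ⊤) :
    ConnectedSet (cayleyAdj A) Set.univ := by
  intro X _ hX
  rcases X.eq_empty_or_nonempty with h | ⟨x, hx⟩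
  · exact Or.inl h
  right
  have step : ∀ y ∈ X, ∀ a ∈ A ∪ A⁻¹, y * a ∈ X := by
    intro y hy a ha
    by_contra h
    exact hX y hy (y * a) ⟨Set.mem_univ _, h⟩ (by simpa [cayleyAdj] using ha)
  have key : ∀ g : G, ∀ y ∈ X, y * g ∈ X := by
    intro g
    have hg : g ∈ Subgroup.closure A := by rw [hgen]; trivial
    induction hg using Subgroup.closure_induction'' with
    | mem a ha => exact fun y hy => step y hy a (Or.inl ha)
    | inv_mem a ha => exact fun y hy => step y hy a⁻¹ (Or.inr (by simpa using ha))
    | one => simp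
    | mul a b _ _ h1 h2 =>
      intro y hy
      rw [← mul_assoc]
      exact h2 _ (h1 _ hy)
  rw [Set.eq_univ_iff_forall]
  intro g
  simpa using key (x⁻¹ * g) x hx

variable {A : Set G} {K : ℕ} {p q : Ultrafilter G} {C D : Set G}

theorem edgeBoundary_smul (g : G) (C : Set G) :
    edgeBoundary (cayleyAdj A) (g • C) =
      (fun e : G × G => (g * e.1, g * e.2)) '' edgeBoundary (cayleyAdj A) C := by
  ext ⟨a, b⟩
  simp only [edgeBoundary, Set.mem_ofPred_eq, Set.mem_image, Prod.exists, Prod.mk.injEq,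
    Set.mem_smul_set_iff_inv_smul_mem, smul_eq_mul]
  constructor
  · rintro ⟨h1, h2, h3⟩
    exact ⟨g⁻¹ * a, g⁻¹ * b, ⟨h1, h2, (cayleyAdj_mul_left A _ _ _).2 h3⟩, by simp, by simp⟩
  · rintro ⟨x, y, ⟨h1, h2, h3⟩, rfl, rfl⟩
    exact ⟨by simpa using h1, by simpa using h2, (cayleyAdj_mul_left A _ _ _).2 h3⟩

theorem encard_edgeBoundary_smul (g : G) (C : Set G) :
    (edgeBoundary (cayleyAdj A) (g • C)).encard = (edgeBoundary (cayleyAdj A) C).encard := by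
  rw [edgeBoundary_smul, Function.Injective.encard_image]
  rintro ⟨a, b⟩ ⟨c, d⟩ h
  simpa using h

theorem ConnectedSet.smul (h : ConnectedSet (cayleyAdj A) C) (g : G) :
    ConnectedSet (cayleyAdj A) (g • C) := by
  intro X hX hXe
  have := h (g⁻¹ • X) (by rwa [Set.subset_smul_set_iff] at hX) (by
    intro a ha b hb hab
    rw [Set.mem_smul_set_iff_inv_smul_mem, inv_inv] at ha
    refine hXe (g * a) ha (g * b) ⟨Set.smul_mem_smul_set hb.1, fun h => hb.2 ?_⟩
      ((cayleyAdj_mul_left A _ _ _).2 hab)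
    rwa [Set.mem_smul_set_iff_inv_smul_mem, inv_inv])
  rcases this with h | h
  · left; simpa using h
  · right; rw [← h, smul_inv_smul]

theorem smul_mem_connCuts (h : C ∈ connCuts (cayleyAdj A) K) (g : G) :
    g • C ∈ connCuts (cayleyAdj A) K :=
  ⟨h.1.smul g, by rw [← Set.smul_set_compl]; exact h.2.1.smul g,
    by rw [encard_edgeBoundary_smul]; exact h.2.2⟩

theorem Cross.smul (h : Cross C D) (g : G) : Cross (g • C) (g • D) := by
  unfold Cross at *
  simp only [← Set.smul_set_compl, ← Set.smul_set_inter, Set.smul_set_nonempty]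
  exact h

theorem cross_smul_iff (g : G) : Cross (g • C) (g • D) ↔ Cross C D :=
  ⟨fun h => by simpa using h.smul g⁻¹, fun h => h.smul g⟩

theorem smul_mem_map_iff (g : G) : g • C ∈ p.map (g * ·) ↔ C ∈ p := by
  rw [Ultrafilter.mem_map]
  have : (g * ·) ⁻¹' (g • C) = C := by
    ext x
    simp [Set.mem_smul_set_iff_inv_smul_mem]
  rw [this]

theorem IsMinCut.smul (h : IsMinCut (cayleyAdj A) K p q C) (g : G) :
    IsMinCut (cayleyAdj A) K (p.map (g * ·)) (q.map (g * ·)) (g • C) := by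
  obtain ⟨h1, h2, h3, h4⟩ := h
  refine ⟨(smul_mem_map_iff g).2 h1, fun h => h2 ((smul_mem_map_iff g).1 h),
    by rwa [encard_edgeBoundary_smul], fun D hp hq => ?_⟩
  obtain ⟨D, rfl⟩ : ∃ D', D = g • D' := ⟨g⁻¹ • D, by simp⟩
  rw [smul_mem_map_iff] at hp hq
  rw [encard_edgeBoundary_smul, encard_edgeBoundary_smul]
  exact h4 D hp hq

theorem smul_mem_minCuts (h : C ∈ minCuts (cayleyAdj A) K) (g : G) :
    g • C ∈ minCuts (cayleyAdj A) K := by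
  obtain ⟨p, q, h⟩ := h
  exact ⟨_, _, h.smul g⟩

theorem crossNum_smul (g : G) : crossNum (cayleyAdj A) K (g • C) = crossNum (cayleyAdj A) K C := by
  unfold crossNum
  rw [← Set.ncard_image_of_injective {D | D ∈ minCuts (cayleyAdj A) K ∧ Cross D C}
    (MulAction.injective g)]
  congr 1
  ext D
  constructor
  · rintro ⟨h1, h2⟩
    exact ⟨g⁻¹ • D, ⟨smul_mem_minCuts h1 _, by simpa using h2.smul g⁻¹⟩, by simp⟩
  · rintro ⟨D, ⟨h1, h2⟩, rfl⟩
    exact ⟨smul_mem_minCuts h1 _, h2.smul g⟩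

theorem smul_mem_optCuts (h : C ∈ optCuts (cayleyAdj A) K) (g : G) :
    g • C ∈ optCuts (cayleyAdj A) K := by
  obtain ⟨p, q, h⟩ := h
  refine ⟨_, _, h.1.smul g, fun D hD => ?_⟩
  have := hD.smul g⁻¹
  simp only [Ultrafilter.map_map, Function.comp_def, inv_mul_cancel_left] at this
  rw [crossNum_smul, ← crossNum_smul (C := D) g⁻¹]
  exact h.2 _ (by simpa using this)

theorem finite_transporter (hC : (edgeBoundary (cayleyAdj A) C).Nonempty)
    (hD : (edgeBoundary (cayleyAdj A) D).Finite) : {g : G | g • C = D}.Finite := by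
  obtain ⟨e, he⟩ := hC
  refine Set.Finite.of_injOn (f := fun g : G => (g * e.1, g * e.2)) ?_ ?_ hD
  · rintro g rfl
    rw [edgeBoundary_smul]
    exact Set.mem_image_of_mem _ he
  · intro g _ h _ hgh
    simpa using congrArg Prod.fst hgh

/-- Each connected cut of size at most `K` has a translate with an edge leaving `1`. -/
def rootedCuts (A : Set G) (K : ℕ) : Set (Set G) :=
  {C | C ∈ connCuts (cayleyAdj A) K ∧ 1 ∈ C ∧ ∃ a ∈ A ∪ A⁻¹, a ∉ C}

theorem finite_rootedCuts (hA : A.Finite) (hgen : Subgroup.closure A = ⊤) :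
    (rootedCuts A K).Finite := by
  refine ((hA.union hA.inv).biUnion fun a _ => finite_connCuts_separating K (cayleyAdj_symm A)
    (connectedSet_cayleyAdj hgen) 1 a).subset ?_
  rintro C ⟨hC, h1, a, ha, haC⟩
  simp only [Set.mem_iUnion]
  exact ⟨a, ha, hC, h1, haC⟩

theorem exists_smul_mem_rootedCuts (hgen : Subgroup.closure A = ⊤)
    (hC : C ∈ connCuts (cayleyAdj A) K) (h0 : C ≠ ∅) (h1 : C ≠ Set.univ) :
    ∃ g : G, g • C ∈ rootedCuts A K := by
  obtain ⟨⟨a, b⟩, ha, hb, hab⟩ := edgeBoundary_nonempty (connectedSet_cayleyAdj hgen) h0 h1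
  refine ⟨a⁻¹, smul_mem_connCuts hC _, ?_, a⁻¹ * b, hab, ?_⟩
  · simpa [Set.mem_smul_set_iff_inv_smul_mem] using ha
  · simpa [Set.mem_smul_set_iff_inv_smul_mem] using hb

theorem exists_bound_cross (hA : A.Finite) (hgen : Subgroup.closure A = ⊤) (K : ℕ) :
    ∃ M : ℕ, ∀ C ∈ connCuts (cayleyAdj A) K, C ≠ ∅ → C ≠ Set.univ →
      {h : G | h • C = C ∨ Cross (h • C) C}.Finite ∧
      {h : G | h • C = C ∨ Cross (h • C) C}.ncard ≤ M := by
  have hV := connectedSet_cayleyAdj hgen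
  obtain ⟨M, hM⟩ := ((finite_rootedCuts (K := K) hA hgen).image
    fun C : Set G => {h : G | h • C = C ∨ Cross (h • C) C}.ncard).bddAbove
  refine ⟨M, fun C hC h0 h1 => ⟨?_, ?_⟩⟩
  · have hfin := Set.finite_of_encard_le_coe hC.2.2
    have hne := edgeBoundary_nonempty hV h0 h1
    refine ((finite_transporter hne hfin).union
      ((finite_cross_connCuts (k := K) (cayleyAdj_symm A) hV hfin).biUnion
        (t := fun D => {h : G | h • C = D})
        fun D hD => finite_transporter hne (Set.finite_of_encard_le_coe hD.1.2.2))).subset ?_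
    rintro h (hh | hh)
    · exact Or.inl hh
    · right
      simp only [Set.mem_iUnion]
      exact ⟨h • C, ⟨smul_mem_connCuts hC h, hh⟩, rfl⟩
  · obtain ⟨g, hg⟩ := exists_smul_mem_rootedCuts hgen hC h0 h1
    refine le_trans (le_of_eq ?_) (hM (Set.mem_image_of_mem _ hg))
    rw [← Set.ncard_image_of_injective _ (MulAut.conj g).injective]
    congr 1
    ext h
    simp only [Set.mem_image, Set.mem_ofPred_eq, MulAut.conj_apply]
    have key : ∀ x : G, ((g * x * g⁻¹) • g • C = g • C ∨ Cross ((g * x * g⁻¹) • g • C) (g • C)) ↔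
        (x • C = C ∨ Cross (x • C) C) := by
      intro x
      rw [mul_smul, mul_smul, inv_smul_smul, cross_smul_iff, smul_left_cancel_iff]
    constructor
    · rintro ⟨x, hx, rfl⟩
      exact (key x).2 hx
    · intro hh
      refine ⟨g⁻¹ * h * g, (key _).1 ?_, by group⟩
      have : g * (g⁻¹ * h * g) * g⁻¹ = h := by group
      rwa [this]

end GroupCuts

section WordMetric

variable {G : Type*} [Group G] {A : Set G}

theorem wordDist_le_length (A : Set G) {g h : G} {l : List G} (hl : ∀ x ∈ l, x ∈ A ∪ A⁻¹)
    (hp : l.prod = g⁻¹ * h) : wordDist A g h ≤ l.length :=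
  Nat.sInf_le ⟨l, rfl, hl, hp⟩

theorem exists_word_length_eq_wordDist (hgen : Subgroup.closure A = ⊤) (g h : G) :
    ∃ l : List G, l.length = wordDist A g h ∧ (∀ x ∈ l, x ∈ A ∪ A⁻¹) ∧ l.prod = g⁻¹ * h := by
  have hmem : g⁻¹ * h ∈ Subgroup.closure A := by rw [hgen]; trivial
  rw [← Subgroup.mem_toSubmonoid, Subgroup.closure_toSubmonoid] at hmem
  obtain ⟨l, hl, hp⟩ := Submonoid.exists_list_of_mem_closure hmem
  exact Nat.sInf_mem (s := { n : ℕ | ∃ l : List G, l.length = n ∧ (∀ x ∈ l, x ∈ A ∪ A⁻¹) ∧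
    l.prod = g⁻¹ * h }) ⟨_, l, rfl, hl, hp⟩

theorem wordDist_mul_left (A : Set G) (k g h : G) :
    wordDist A (k * g) (k * h) = wordDist A g h := by
  unfold wordDist
  rw [mul_inv_rev, mul_assoc, inv_mul_cancel_left]

theorem wordDist_eq_one_inv_mul (A : Set G) (g h : G) :
    wordDist A g h = wordDist A 1 (g⁻¹ * h) := by
  rw [← wordDist_mul_left A g⁻¹, inv_mul_cancel]

theorem wordDist_triangle (hgen : Subgroup.closure A = ⊤) (x y z : G) :
    wordDist A x z ≤ wordDist A x y + wordDist A y z := by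
  obtain ⟨l, hl, hl', hp⟩ := exists_word_length_eq_wordDist hgen x y
  obtain ⟨m, hm, hm', hq⟩ := exists_word_length_eq_wordDist hgen y z
  rw [← hl, ← hm, ← List.length_append]
  refine wordDist_le_length A (fun a ha => (List.mem_append.1 ha).elim (hl' a) (hm' a)) ?_
  rw [List.prod_append, hp, hq]
  group

theorem wordDist_le_swap (hgen : Subgroup.closure A = ⊤) (x y : G) :
    wordDist A y x ≤ wordDist A x y := by
  obtain ⟨l, hl, hl', hp⟩ := exists_word_length_eq_wordDist hgen x y
  have := wordDist_le_length A (g := y) (h := x) (l := (l.map (·⁻¹)).reverse) (by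
    intro a ha
    simp only [List.mem_reverse, List.mem_map] at ha
    obtain ⟨b, hb, rfl⟩ := ha
    rcases hl' b hb with h | h
    · exact Or.inr (by simpa using h)
    · exact Or.inl (by simpa using h)) (by
    rw [← List.prod_inv_reverse, hp]; group)
  simpa [hl] using this

theorem wordDist_comm (hgen : Subgroup.closure A = ⊤) (x y : G) :
    wordDist A x y = wordDist A y x :=
  (wordDist_le_swap hgen y x).antisymm (wordDist_le_swap hgen x y)

theorem wordDist_self (A : Set G) (x : G) : wordDist A x x = 0 :=
  Nat.le_zero.1 (wordDist_le_length A (l := []) (by simp) (by simp))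

theorem wordDist_le_one_of_cayleyAdj {x y : G} (h : cayleyAdj A x y) : wordDist A x y ≤ 1 :=
  wordDist_le_length A (l := [x⁻¹ * y]) (by simpa [cayleyAdj] using h) (by simp)

theorem eq_or_cayleyAdj_of_wordDist_le_one (hgen : Subgroup.closure A = ⊤) {x y : G}
    (h : wordDist A x y ≤ 1) : x = y ∨ cayleyAdj A x y := by
  obtain ⟨l, hl, hl', hp⟩ := exists_word_length_eq_wordDist hgen x y
  rw [← hl] at h
  match l, h, hl', hp with
  | [], _, _, hp => left; simpa [eq_comm, inv_mul_eq_one] using hp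
  | [a], _, hl', hp =>
    right
    simp only [List.prod_singleton] at hp
    rw [cayleyAdj, ← hp]
    exact hl' a (by simp)
  | _ :: _ :: _, h, _, _ => simp at h

/-- Geodesics for the word metric. -/
theorem exists_geodesic (hgen : Subgroup.closure A = ⊤) (x y : G) :
    ∃ γ : ℕ → G, γ 0 = x ∧ γ (wordDist A x y) = y ∧ IsDiscPath A γ (wordDist A x y) ∧
      ∀ i ≤ wordDist A x y, wordDist A x (γ i) = i ∧ wordDist A (γ i) y + i = wordDist A x y := by
  obtain ⟨l, hl, hl', hp⟩ := exists_word_length_eq_wordDist hgen x y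
  have h1 : ∀ i ≤ l.length, wordDist A x (x * (l.take i).prod) ≤ i := by
    intro i hi
    have := wordDist_le_length A (g := x) (h := x * (l.take i).prod) (l := l.take i)
      (fun a ha => hl' a (List.mem_of_mem_take ha)) (by simp)
    rwa [List.length_take, min_eq_left hi] at this
  have h2 : ∀ i ≤ l.length, wordDist A (x * (l.take i).prod) y ≤ l.length - i := by
    intro i hi
    have := wordDist_le_length A (g := x * (l.take i).prod) (h := y) (l := l.drop i)
      (fun a ha => hl' a (List.mem_of_mem_drop ha)) (by
        rw [mul_inv_rev, mul_assoc, ← hp, ← List.prod_take_mul_prod_drop l i, inv_mul_cancel_left])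
    rwa [List.length_drop] at this
  refine ⟨fun i => x * (l.take i).prod, by simp, ?_, ?_, ?_⟩
  · simp only [← hl, List.take_length, hp, mul_inv_cancel_left]
  · intro i hi
    have hi' : i < l.length := by omega
    refine wordDist_le_one_of_cayleyAdj ?_
    beta_reduce
    rw [cayleyAdj, List.prod_take_succ l i hi', mul_inv_rev, mul_assoc, inv_mul_cancel_left,
      inv_mul_cancel_left]
    exact hl' _ (List.getElem_mem _)
  · intro i hi
    rw [← hl] at hi
    have a1 := h1 i hi
    have a2 := h2 i hi
    have a3 := wordDist_triangle hgen x (x * (l.take i).prod) y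
    simp only
    omega

theorem finite_wordDist_ball (hA : A.Finite) (hgen : Subgroup.closure A = ⊤) (n : ℕ) :
    {g : G | wordDist A 1 g ≤ n}.Finite := by
  induction n with
  | zero =>
    refine (Set.finite_singleton (1 : G)).subset fun g hg => ?_
    obtain ⟨l, hl, -, hp⟩ := exists_word_length_eq_wordDist hgen 1 g
    rw [Nat.le_zero.1 hg, List.length_eq_zero_iff] at hl
    simpa [hl, eq_comm] using hp
  | succ n ih =>
    refine (ih.union (Set.Finite.image2 (· * ·) ih (hA.union hA.inv))).subset fun g hg => ?_
    obtain ⟨γ, h0, h1, hγ, hd⟩ := exists_geodesic hgen 1 g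
    rcases Nat.lt_or_ge n (wordDist A 1 g) with h | h
    · have hg' : wordDist A 1 g = n + 1 := le_antisymm hg h
      rw [hg'] at h1 hγ hd
      rcases eq_or_cayleyAdj_of_wordDist_le_one hgen (hγ n (Nat.lt_succ_self n)) with e | e
      · left
        rw [← h1, ← e]
        exact (hd n (Nat.le_succ n)).1.le
      · right
        refine ⟨γ n, (hd n (Nat.le_succ n)).1.le, _, e, ?_⟩
        simp [h1]
    · exact Or.inl h

theorem mem_of_wordDist_le (hgen : Subgroup.closure A = ⊤) {n : ℕ} {X : Set G} (h1 : (1 : G) ∈ X)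
    (hX : ∀ a ∈ X, ∀ b, cayleyAdj A a b → wordDist A 1 b ≤ n → b ∈ X) {g : G}
    (hg : wordDist A 1 g ≤ n) : g ∈ X := by
  obtain ⟨γ, h0, hγ1, hγ, hd⟩ := exists_geodesic hgen 1 g
  have : ∀ i ≤ wordDist A 1 g, γ i ∈ X := by
    intro i
    induction i with
    | zero => intro _; rwa [h0]
    | succ i ih =>
      intro hi
      have hm := ih (by omega)
      rcases eq_or_cayleyAdj_of_wordDist_le_one hgen (hγ i (by omega)) with e | e
      · rwa [← e]
      · exact hX _ hm _ e (by rw [(hd _ hi).1]; omega)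
  rw [← hγ1]
  exact this _ le_rfl

/-- Every discrete triangle has a vertex on each side, pairwise within distance `m`. -/
def HasTriangleMesh (A : Set G) (m : ℕ) : Prop :=
  ∀ (n : Fin 3 → ℕ) (γ : Fin 3 → ℕ → G), (∀ i, IsDiscPath A (γ i) (n i)) →
    (∀ i : Fin 3, γ i (n i) = γ (i + 1) 0) →
    ∃ u : Fin 3 → ℕ, (∀ i, u i ≤ n i) ∧ ∀ i j, wordDist A (γ i (u i)) (γ j (u j)) ≤ m

theorem HasTriangleMesh.exists_near_geodesic (hgen : Subgroup.closure A = ⊤) {m : ℕ}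
    (hm : HasTriangleMesh A m) {x y z : G} (hz : wordDist A x z + wordDist A z y = wordDist A x y)
    {γ : ℕ → G} {n : ℕ} (hγ : IsDiscPath A γ n) (h0 : γ 0 = y) (hn : γ n = x) :
    ∃ j ≤ n, wordDist A z (γ j) ≤ 2 * m := by
  obtain ⟨α, a0, a1, ha, hda⟩ := exists_geodesic hgen x z
  obtain ⟨β, b0, b1, hb, hdb⟩ := exists_geodesic hgen z y
  obtain ⟨u, hu, hd⟩ := hm ![wordDist A x z, wordDist A z y, n] ![α, β, γ]
    (by intro i; fin_cases i <;> assumption)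
    (by intro i; fin_cases i <;> simp [*])
  have hu0 : u 0 ≤ wordDist A x z := hu 0
  have hu1 : u 1 ≤ wordDist A z y := hu 1
  have d01 : wordDist A (α (u 0)) (β (u 1)) ≤ m := hd 0 1
  have d02 : wordDist A (α (u 0)) (γ (u 2)) ≤ m := hd 0 2
  refine ⟨u 2, hu 2, ?_⟩
  have t1 := wordDist_triangle hgen x (α (u 0)) y
  have t2 := wordDist_triangle hgen (α (u 0)) (β (u 1)) y
  have t3 := wordDist_triangle hgen z (α (u 0)) (γ (u 2))
  have e0 := hda _ hu0
  have e1 := hdb _ hu1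
  rw [wordDist_comm hgen z (α (u 0))] at t3
  omega

theorem exists_discPath_of_reflTransGen {P : G → Prop} {x y : G} (hx : P x)
    (h : Relation.ReflTransGen (fun a b => cayleyAdj A a b ∧ P b) x y) :
    ∃ (n : ℕ) (γ : ℕ → G), γ 0 = x ∧ γ n = y ∧ IsDiscPath A γ n ∧ ∀ i ≤ n, P (γ i) := by
  induction h with
  | refl => exact ⟨0, fun _ => x, rfl, rfl, fun i hi => absurd hi (by omega), fun _ _ => hx⟩
  | @tail b c _ hbc ih =>
    obtain ⟨n, γ, h0, hn, hγ, hP⟩ := ih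
    refine ⟨n + 1, fun i => if i ≤ n then γ i else c, by simpa using h0, by simp, ?_, ?_⟩
    · intro i hi
      by_cases h : i = n
      · subst h
        simpa [hn] using wordDist_le_one_of_cayleyAdj hbc.1
      · have h1 : i ≤ n := by omega
        have h2 : i + 1 ≤ n := by omega
        simpa only [h1, h2, if_true] using hγ i (by omega)
    · intro i hi
      by_cases h : i ≤ n
      · simpa only [h, if_true] using hP i h
      · simpa only [h, if_false] using hbc.2

end WordMetric

section EndsOfSubgroups

open Pointwise

variable {G : Type*} [Group G] {A : Set G}

theorem exists_far_cut (hA : A.Finite) (hgen : Subgroup.closure A = ⊤) {m : ℕ}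
    (hm : HasTriangleMesh A m) : ∃ K : ℕ, ∀ H : Set G, H.Infinite → ∀ n : ℕ,
      ∃ C : Set G, (edgeBoundary (cayleyAdj A) C).encard ≤ K ∧
        (∀ g, wordDist A 1 g ≤ n → g ∉ C) ∧ (H ∩ C).Infinite := by
  have hfin := (finite_wordDist_ball hA hgen (2 * m)).prod (hA.union hA.inv)
  refine ⟨({g : G | wordDist A 1 g ≤ 2 * m} ×ˢ (A ∪ A⁻¹)).ncard, fun H hH n => ?_⟩
  set t := n + 2 * m + 1 with ht
  obtain ⟨z, hzt, hz⟩ : ∃ z : G, wordDist A 1 z = t ∧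
      {h | h ∈ H ∧ wordDist A 1 z + wordDist A z h = wordDist A 1 h}.Infinite := by
    by_contra hcon
    have hcon' : ∀ z, wordDist A 1 z = t →
        {h | h ∈ H ∧ wordDist A 1 z + wordDist A z h = wordDist A 1 h}.Finite := by
      intro z hz
      by_contra h
      exact hcon ⟨z, hz, h⟩
    refine hH (((finite_wordDist_ball hA hgen t).union (((finite_wordDist_ball hA hgen t).subset
      (fun z (hz : wordDist A 1 z = t) => hz.le)).biUnion hcon')).subset fun h hh => ?_)
    rcases le_total (wordDist A 1 h) t with hle | hle
    · exact Or.inl hle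
    · right
      obtain ⟨γ, -, -, -, hd⟩ := exists_geodesic hgen 1 h
      obtain ⟨e1, e2⟩ := hd t hle
      simp only [Set.mem_iUnion]
      exact ⟨γ t, e1, hh, by omega⟩
  let P : G → Prop := fun b => 2 * m < wordDist A z b
  let U : Set G := {x | Relation.ReflTransGen (fun a b => cayleyAdj A a b ∧ P b) 1 x}
  have h1P : P 1 := by
    change 2 * m < wordDist A z 1
    rw [wordDist_comm hgen, hzt]
    omega
  refine ⟨Uᶜ, ?_, ?_, ?_⟩
  · rw [hfin.cast_ncard_eq]
    refine le_trans (Set.encard_le_encard ?_)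
      (Set.encard_image_le (fun e : G × G => (z * e.1, z * e.1 * e.2)) _)
    rintro ⟨a, b⟩ ⟨ha, hb, hab⟩
    simp only [Set.mem_compl_iff, not_not] at ha hb hab
    refine ⟨(z⁻¹ * a, a⁻¹ * b), ⟨?_, hab⟩, by simp⟩
    change wordDist A 1 (z⁻¹ * a) ≤ 2 * m
    rw [← wordDist_eq_one_inv_mul]
    by_contra hcon
    exact ha (Relation.ReflTransGen.tail hb ⟨cayleyAdj_symm A _ _ hab, not_le.1 hcon⟩)
  · intro g hg
    simp only [Set.mem_compl_iff, not_not]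
    refine mem_of_wordDist_le hgen (X := U) Relation.ReflTransGen.refl ?_ hg
    intro a ha b hab hb
    refine Relation.ReflTransGen.tail ha ⟨hab, ?_⟩
    have := wordDist_triangle hgen 1 b z
    rw [wordDist_comm hgen b z] at this
    change 2 * m < wordDist A z b
    omega
  · refine hz.mono fun h hh => ⟨hh.1, fun hU => ?_⟩
    obtain ⟨k, γ, h0, hk, hγ, hP⟩ := exists_discPath_of_reflTransGen h1P hU
    obtain ⟨j, hj, hle⟩ := hm.exists_near_geodesic hgen (x := h) (y := 1) (z := z) (by
      rw [wordDist_comm hgen h z, wordDist_comm hgen z 1, wordDist_comm hgen h 1, ← hh.2,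
        add_comm]) hγ h0 hk
    exact absurd (hP j hj) (not_lt.2 hle)

theorem infinite_diff_of_smul_ssubset {H : Subgroup G} {C : Set G} {g : G} (hg : g ∈ H)
    (hC : g • C ⊂ C) (h1 : (1 : G) ∉ C) : ((H : Set G) \ C).Infinite := by
  have hsub : ∀ n : ℕ, g ^ n • C ⊆ C := by
    intro n
    induction n with
    | zero => simp
    | succ n ih =>
      rw [pow_succ, mul_smul]
      exact (Set.smul_set_mono hC.1).trans ih
  have hord : ¬ IsOfFinOrder g := by
    intro h
    obtain ⟨n, hn, hpow⟩ := isOfFinOrder_iff_pow_eq_one.1 h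
    obtain ⟨k, rfl⟩ : ∃ k, n = k + 1 := ⟨n - 1, by omega⟩
    have hk : g • g ^ k • C ⊆ g • C := Set.smul_set_mono (hsub k)
    rw [← mul_smul, ← pow_succ', hpow, one_smul] at hk
    exact hC.2 hk
  refine Set.infinite_of_injective_forall_mem (f := fun n : ℕ => (g⁻¹) ^ n)
    (injective_pow_iff_not_isOfFinOrder.2 (by rwa [isOfFinOrder_inv_iff])) fun n => ?_
  refine ⟨H.pow_mem (H.inv_mem hg) n, fun hn => h1 (hsub n ?_)⟩
  rw [Set.mem_smul_set_iff_inv_smul_mem]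
  simpa using hn

theorem exists_connCut_of_far_cut (hgen : Subgroup.closure A = ⊤) {K n : ℕ} {H : Set G}
    (hH : H.Infinite)
    (hdich : ∀ C : Set G, (edgeBoundary (cayleyAdj A) C).encard ≤ K → (H ∩ C).Infinite →
      (H \ C).Finite) {C₀ : Set G} (hK : (edgeBoundary (cayleyAdj A) C₀).encard ≤ K)
    (hn : ∀ g, wordDist A 1 g ≤ n → g ∉ C₀) (hC₀ : (H ∩ C₀).Infinite) :
    ∃ C ∈ connCuts (cayleyAdj A) K, (∀ g, wordDist A 1 g ≤ n → g ∉ C) ∧ (H \ C).Finite := by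
  have hV := connectedSet_cayleyAdj hgen
  have hE := cayleyAdj_symm A
  obtain ⟨C, ⟨hCn, hCH⟩, hmin⟩ := exists_minimalFor_of_wellFoundedLT
    (fun C : Set G => (∀ g, wordDist A 1 g ≤ n → g ∉ C) ∧ (H \ C).Finite)
    (fun C => (edgeBoundary (cayleyAdj A) C).encard) ⟨C₀, hn, hdich C₀ hK hC₀⟩
  have hle : ∀ D : Set G, (∀ g, wordDist A 1 g ≤ n → g ∉ D) → (H \ D).Finite →
      (edgeBoundary (cayleyAdj A) C).encard ≤ (edgeBoundary (cayleyAdj A) D).encard :=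
    fun D h1 h2 => (le_total _ _).elim id fun h => hmin ⟨h1, h2⟩ h
  have hCK := (hle C₀ hn (hdich C₀ hK hC₀)).trans hK
  have h1 : (1 : G) ∉ C := hCn 1 (by rw [wordDist_self]; exact Nat.zero_le _)
  refine ⟨C, ⟨?_, ?_, hCK⟩, hCn, hCH⟩
  · refine connectedSet_of_minimal hE hV (fun h => h1 (by rw [h]; trivial))
      (Set.finite_of_encard_le_coe hCK) fun X hX hXe => ?_
    have hXC : (edgeBoundary (cayleyAdj A) X).encard ≤ K := by
      refine (Set.encard_le_encard ?_).trans hCK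
      rintro ⟨a, b⟩ ⟨ha, hb, hab⟩
      exact ⟨hX ha, fun h => hXe a ha b ⟨h, hb⟩ hab, hab⟩
    by_cases hXH : (H ∩ X).Infinite
    · exact Or.inl (hle X (fun g hg h => hCn g hg (hX h)) (hdich X hXC hXH))
    · refine Or.inr (hle (C \ X) (fun g hg h => hCn g hg h.1) ?_)
      refine (hCH.union (Set.not_infinite.1 hXH)).subset fun x hx => ?_
      by_cases hxC : x ∈ C
      · exact Or.inr ⟨hx.1, by by_contra h; exact hx.2 ⟨hxC, h⟩⟩
      · exact Or.inl ⟨hx.1, hxC⟩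
  · have hCu : Cᶜ ≠ Set.univ := by
      intro h
      rw [Set.compl_univ_iff] at h
      simp only [h, Set.sdiff_empty] at hCH
      exact hH hCH
    have key : ∀ X ⊆ Cᶜ, (∀ a ∈ X, ∀ b ∈ Cᶜ \ X, ¬ cayleyAdj A a b) → (1 : G) ∈ X →
        (edgeBoundary (cayleyAdj A) Cᶜ).encard ≤ (edgeBoundary (cayleyAdj A) X).encard := by
      intro X hX hXe hX1
      rw [encard_edgeBoundary_compl hE, ← encard_edgeBoundary_compl hE X]
      refine hle Xᶜ (fun g hg => not_not.2 (mem_of_wordDist_le hgen hX1 ?_ hg))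
        (hCH.subset fun x hx => ⟨hx.1, fun h => hx.2 fun h' => hX h' h⟩)
      intro a ha b hab hb
      by_contra h
      exact hXe a ha b ⟨hCn b hb, h⟩ hab
    refine connectedSet_of_minimal hE hV hCu
      (Set.finite_of_encard_le_coe ((encard_edgeBoundary_compl hE C).le.trans hCK))
      fun X hX hXe => ?_
    by_cases hX1 : (1 : G) ∈ X
    · exact Or.inl (key X hX hXe hX1)
    · refine Or.inr (key _ Set.sdiff_subset ?_ ⟨h1, hX1⟩)
      intro a ha b hb hab
      have hbX : b ∈ X := by by_contra h; exact hb.2 ⟨hb.1, h⟩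
      exact hXe b hbX a ha (hE _ _ hab)

/-- Every infinite subgroup is split into two infinite parts by a cut of uniformly bounded size. -/
theorem exists_splitting_cut (hA : A.Finite) (hgen : Subgroup.closure A = ⊤) {m : ℕ}
    (hm : HasTriangleMesh A m) : ∃ K : ℕ, ∀ H : Subgroup G, (H : Set G).Infinite →
      ∃ C : Set G, (edgeBoundary (cayleyAdj A) C).encard ≤ K ∧
        ((H : Set G) ∩ C).Infinite ∧ ((H : Set G) \ C).Infinite := by
  obtain ⟨K, hK⟩ := exists_far_cut hA hgen hm
  obtain ⟨M, hM⟩ := exists_bound_cross hA hgen K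
  refine ⟨K, fun H hH => ?_⟩
  by_contra hcon
  have hdich : ∀ C : Set G, (edgeBoundary (cayleyAdj A) C).encard ≤ K →
      ((H : Set G) ∩ C).Infinite → ((H : Set G) \ C).Finite := by
    intro C h1 h2
    by_contra h3
    exact hcon ⟨C, h1, h2, h3⟩
  obtain ⟨F, hFH, hFcard⟩ := hH.exists_subset_card_eq (M + 1)
  obtain ⟨n, hn⟩ := (F.finite_toSet.image fun h => wordDist A 1 h⁻¹).bddAbove
  obtain ⟨C₀, hC₀K, hC₀n, hC₀H⟩ := hK H hH n
  obtain ⟨C, hC, hCn, hCH⟩ := exists_connCut_of_far_cut hgen hH hdich hC₀K hC₀n hC₀H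
  have h1 : (1 : G) ∉ C := hCn 1 (by rw [wordDist_self]; exact Nat.zero_le _)
  have hC0 : C ≠ ∅ := by
    rintro rfl
    rw [Set.sdiff_empty] at hCH
    exact hH hCH
  have hC1 : C ≠ Set.univ := fun h => h1 (by rw [h]; trivial)
  obtain ⟨hfin, hcard⟩ := hM C hC hC0 hC1
  obtain ⟨h, hhF, hh⟩ : ∃ h ∈ F, ¬ (h • C = C ∨ Cross (h • C) C) := by
    by_contra hall
    push Not at hall
    have := Set.ncard_le_ncard (s := (F : Set G)) (t := {h : G | h • C = C ∨ Cross (h • C) C})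
      (fun h hh => show h • C = C ∨ Cross (h • C) C by
        by_cases e : h • C = C
        · exact Or.inl e
        · exact Or.inr ((hall h hh).resolve_left e)) hfin
    rw [Set.ncard_coe_finset, hFcard] at this
    omega
  have hhH : h ∈ H := hFH hhF
  rw [not_or, not_cross_iff] at hh
  obtain ⟨hne, hh⟩ := hh
  rcases hh with hh | hh | hh | hh
  · refine hH ((hCH.union (hCH.image (h * ·))).subset fun x hx => ?_)
    by_cases hxC : x ∈ C
    · right
      refine ⟨h⁻¹ * x, ⟨H.mul_mem (H.inv_mem hhH) hx, fun hx' => ?_⟩, by simp⟩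
      have : x ∈ h • C ∩ C := ⟨Set.mem_smul_set_iff_inv_smul_mem.2 hx', hxC⟩
      simp [hh] at this
    · exact Or.inl ⟨hx, hxC⟩
  · exact infinite_diff_of_smul_ssubset hhH (hh.ssubset_of_ne hne) h1 hCH
  · refine infinite_diff_of_smul_ssubset (H.inv_mem hhH)
      ((?_ : h⁻¹ • C ⊆ C).ssubset_of_ne ?_) h1 hCH
    · rwa [Set.smul_set_subset_iff_subset_inv_smul_set, inv_inv]
    · intro e
      rw [inv_smul_eq_iff] at e
      exact hne e.symm
  · have hmem : (1 : G) ∈ h • C ∪ C := by rw [hh]; trivial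
    rcases hmem with hmem | hmem
    · refine hCn h⁻¹ (hn (Set.mem_image_of_mem _ hhF)) ?_
      rw [Set.mem_smul_set_iff_inv_smul_mem] at hmem
      simpa using hmem
    · exact h1 hmem

end EndsOfSubgroups

section CutTree

variable {X : Type*}

/-- An orientation of a system `𝓔` of cuts: it chooses one side of every cut, is upward closed, and
agrees with the orientation towards the point `x₀` up to finitely many cuts. -/
structure IsOrientation (𝓔 : Set (Set X)) (x₀ : X) (σ : Set (Set X)) : Prop where
  subset : σ ⊆ 𝓔
  compl_notMem_iff : ∀ C ∈ 𝓔, Cᶜ ∉ σ ↔ C ∈ σ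
  mem_of_subset : ∀ C ∈ σ, ∀ D ∈ 𝓔, C ⊆ D → D ∈ σ
  finite : {C | C ∈ σ ∧ x₀ ∉ C}.Finite

/-- A nested system of proper cuts, closed under complements. -/
structure IsNestedSystem (𝓔 : Set (Set X)) : Prop where
  compl_mem : ∀ C ∈ 𝓔, Cᶜ ∈ 𝓔
  not_cross : ∀ C ∈ 𝓔, ∀ D ∈ 𝓔, ¬ Cross C D
  empty_notMem : ∅ ∉ 𝓔
  finite_separating : ∀ x y, {C | C ∈ 𝓔 ∧ x ∈ C ∧ y ∉ C}.Finite

variable {𝓔 : Set (Set X)} {x₀ : X} {σ τ : Set (Set X)} {C D : Set X}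

theorem IsOrientation.compl_notMem (hσ : IsOrientation 𝓔 x₀ σ) (hC : C ∈ σ) : Cᶜ ∉ σ :=
  (hσ.compl_notMem_iff C (hσ.subset hC)).2 hC

theorem IsOrientation.compl_mem (hσ : IsOrientation 𝓔 x₀ σ) (h : C ∈ 𝓔) (hC : C ∉ σ) : Cᶜ ∈ σ := by
  by_contra hcon
  exact hC ((hσ.compl_notMem_iff C h).1 hcon)

theorem IsNestedSystem.isOrientation_toward (h : IsNestedSystem 𝓔) (x₀ x : X) :
    IsOrientation 𝓔 x₀ {C | C ∈ 𝓔 ∧ x ∈ C} where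
  subset := fun _ hC => hC.1
  compl_notMem_iff := fun C hC => by simp [hC, h.compl_mem C hC]
  mem_of_subset := fun C hC D hD hCD => ⟨hD, hCD hC.2⟩
  finite := (h.finite_separating x x₀).subset fun _ hC => ⟨hC.1.1, hC.1.2, hC.2⟩

theorem IsOrientation.eq_of_subset (hσ : IsOrientation 𝓔 x₀ σ) (hτ : IsOrientation 𝓔 x₀ τ)
    (h : σ ⊆ τ) : σ = τ := by
  refine h.antisymm fun C hC => ?_
  by_contra hcon
  exact hτ.compl_notMem hC (h (hσ.compl_mem (hτ.subset hC) hcon))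

/-- An orientation is determined by any of its minimal elements. -/
theorem IsOrientation.eq_of_minimal (h : IsNestedSystem 𝓔) (hσ : IsOrientation 𝓔 x₀ σ)
    (hτ : IsOrientation 𝓔 x₀ τ) (hCσ : C ∈ σ) (hCτ : C ∈ τ) (hσm : ∀ D ∈ σ, D ⊆ C → D = C)
    (hτm : ∀ D ∈ τ, D ⊆ C → D = C) : σ = τ := by
  refine hσ.eq_of_subset hτ fun D hD => ?_
  have hD𝓔 := hσ.subset hD
  by_contra hcon
  have hDc := hτ.compl_mem hD𝓔 hcon
  rcases not_cross_iff.1 (h.not_cross C (hσ.subset hCσ) D hD𝓔) with e | e | e | e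
  · refine hσ.compl_notMem hCσ (hσ.mem_of_subset D hD _ (h.compl_mem _ (hσ.subset hCσ)) ?_)
    intro x hx hxC
    have : x ∈ C ∩ D := ⟨hxC, hx⟩
    simp [e] at this
  · exact hcon (hτ.mem_of_subset C hCτ D hD𝓔 e)
  · exact hcon (hσm D hD e ▸ hCτ)
  · have hsub : Dᶜ ⊆ C := fun x hx => by
      have : x ∈ C ∪ D := by rw [e]; trivial
      exact this.resolve_right hx
    exact hσ.compl_notMem hD (hτm _ hDc hsub ▸ hCσ)

theorem IsOrientation.flip (h : IsNestedSystem 𝓔) (hσ : IsOrientation 𝓔 x₀ σ) (hC : C ∈ σ)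
    (hm : ∀ D ∈ σ, D ⊆ C → D = C) : IsOrientation 𝓔 x₀ (insert Cᶜ (σ \ {C})) where
  subset := Set.insert_subset (h.compl_mem C (hσ.subset hC)) (Set.sdiff_subset.trans hσ.subset)
  compl_notMem_iff := fun D hD => by
    have h1 := hσ.compl_notMem_iff D hD
    have h2 := hσ.compl_notMem hC
    by_cases e : D = C
    · subst e
      have : D ≠ Dᶜ := fun e => h2 (e ▸ hC)
      simp [this]
    · by_cases e' : D = Cᶜ
      · have : C ≠ Cᶜ := fun e => h2 (e ▸ hC)
        simp [e', this]
      · have e'' : Dᶜ ≠ C := fun e => e' (by rw [← e, compl_compl])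
        simp [e, e', e'', h1]
  mem_of_subset := by
    have hne : ∅ ∉ σ := fun h' => h.empty_notMem (hσ.subset h')
    rintro D (rfl | ⟨hD, hDC⟩) F hF hDF
    · by_cases e : F = Cᶜ
      · exact Or.inl e
      · right
        constructor
        · by_contra hcon
          have := hm _ (hσ.compl_mem hF hcon) (Set.compl_subset_comm.1 hDF)
          exact e (by rw [← this, compl_compl])
        · rintro rfl
          have hemp : Fᶜ = ∅ := by
            ext x
            exact ⟨fun hx => hx (hDF hx), fun hx => hx.elim⟩
          exact h.empty_notMem (hemp ▸ h.compl_mem F hF)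
    · refine Or.inr ⟨hσ.mem_of_subset D hD F hF hDF, ?_⟩
      rintro rfl
      exact hDC (hm D hD hDF)
  finite := ((Set.finite_singleton Cᶜ).union hσ.finite).subset fun D hD => by
    rcases hD with ⟨rfl | hD, hx⟩
    · exact Or.inl rfl
    · exact Or.inr ⟨hD.1, hx⟩

theorem IsOrientation.finite_diff (hσ : IsOrientation 𝓔 x₀ σ) (hτ : IsOrientation 𝓔 x₀ τ) :
    (σ \ τ).Finite := by
  refine (hσ.finite.union (hτ.finite.image compl)).subset fun C hC => ?_
  by_cases hx : x₀ ∈ C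
  · exact Or.inr ⟨Cᶜ, ⟨hτ.compl_mem (hσ.subset hC.1) hC.2, not_not.2 hx⟩, compl_compl C⟩
  · exact Or.inl ⟨hC.1, hx⟩

theorem IsOrientation.exists_minimal_of_ne (hσ : IsOrientation 𝓔 x₀ σ)
    (hτ : IsOrientation 𝓔 x₀ τ) (hne : σ ≠ τ) :
    ∃ C ∈ σ, C ∉ τ ∧ ∀ D ∈ σ, D ⊆ C → D = C := by
  have hne' : (σ \ τ).Nonempty := by
    rw [Set.sdiff_nonempty]
    exact fun h => hne (hσ.eq_of_subset hτ h)
  obtain ⟨C, hC⟩ := (hσ.finite_diff hτ).exists_minimal hne'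
  refine ⟨C, hC.1.1, hC.1.2, fun D hD hDC => hDC.antisymm (hC.2 ⟨hD, fun hDτ => ?_⟩ hDC)⟩
  exact hC.1.2 (hτ.mem_of_subset D hDτ C (hσ.subset hC.1.1) hDC)

/-- The graph whose vertices are the orientations of a system of cuts; two of them are adjacent
if they differ in one cut only. -/
def cutGraph (𝓔 : Set (Set X)) (x₀ : X) : SimpleGraph {σ // IsOrientation 𝓔 x₀ σ} where
  Adj σ τ := ∃ C ∈ σ.1, τ.1 = insert Cᶜ (σ.1 \ {C})
  symm := ⟨by
    rintro ⟨σ, hσ⟩ ⟨τ, hτ⟩ ⟨C, hC, h⟩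
    have h2 := hσ.compl_notMem hC
    refine ⟨Cᶜ, h ▸ Set.mem_insert _ _, ?_⟩
    simp only at h hC ⊢
    subst h
    simp [h2, hC]⟩
  loopless := ⟨by
    rintro ⟨σ, hσ⟩ ⟨C, hC, h⟩
    exact hσ.compl_notMem hC (h.symm.subset (Set.mem_insert _ _))⟩

theorem notMem_of_eq_flip (hσ : IsOrientation 𝓔 x₀ σ) (hC : C ∈ σ)
    (h : τ = insert Cᶜ (σ \ {C})) : C ∉ τ := by
  have : C ≠ Cᶜ := fun e => hσ.compl_notMem hC (e ▸ hC)
  simp [h, this]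

theorem minimal_of_eq_flip (hσ : IsOrientation 𝓔 x₀ σ) (hτ : IsOrientation 𝓔 x₀ τ) (hC : C ∈ σ)
    (h : τ = insert Cᶜ (σ \ {C})) : ∀ D ∈ σ, D ⊆ C → D = C := by
  intro D hD hDC
  by_contra hne
  refine notMem_of_eq_flip hσ hC h (hτ.mem_of_subset D ?_ C (hσ.subset hC) hDC)
  rw [h]
  exact Or.inr ⟨hD, hne⟩

theorem IsNestedSystem.cutGraph_preconnected (h : IsNestedSystem 𝓔) :
    (cutGraph 𝓔 x₀).Preconnected := by
  rintro ⟨σ, hσ⟩ ⟨τ, hτ⟩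
  induction hn : (σ \ τ).ncard generalizing σ with
  | zero =>
    rw [Set.ncard_eq_zero (hσ.finite_diff hτ), Set.sdiff_eq_empty] at hn
    obtain rfl := hσ.eq_of_subset hτ hn
    exact SimpleGraph.Reachable.refl _
  | succ n ih =>
    obtain ⟨C, hC, hCτ, hm⟩ := hσ.exists_minimal_of_ne hτ (by rintro rfl; simp at hn)
    have hadj : (cutGraph 𝓔 x₀).Adj ⟨σ, hσ⟩ ⟨_, hσ.flip h hC hm⟩ := ⟨C, hC, rfl⟩
    refine hadj.reachable.trans (ih _ _ ?_)
    have e : insert Cᶜ (σ \ {C}) \ τ = (σ \ τ) \ {C} := by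
      rw [Set.insert_sdiff_of_mem _ (hτ.compl_mem (hσ.subset hC) hCτ), Set.sdiff_sdiff_comm]
    rw [e, Set.ncard_sdiff_singleton_of_mem (show C ∈ σ \ τ from ⟨hC, hCτ⟩), hn]
    rfl

theorem IsNestedSystem.cutGraph_isTree (h : IsNestedSystem 𝓔) : (cutGraph 𝓔 x₀).IsTree := by
  have : Nonempty {σ // IsOrientation 𝓔 x₀ σ} := ⟨⟨_, h.isOrientation_toward x₀ x₀⟩⟩
  refine ⟨⟨h.cutGraph_preconnected⟩, ?_⟩
  rw [SimpleGraph.isAcyclic_iff_forall_adj_isBridge]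
  rintro σ τ hadj
  rw [SimpleGraph.isBridge_iff, SimpleGraph.reachable_iff_reflTransGen]
  obtain ⟨C, hC, hτ⟩ := id hadj
  intro hcon
  refine notMem_of_eq_flip σ.2 hC hτ ?_
  -- flipping `C` is only possible along the edge from `σ` to `τ`
  have key : ∀ α β, (cutGraph 𝓔 x₀).Adj α β → C ∈ α.1 → C ∉ β.1 → α = σ ∧ β = τ := by
    rintro α β ⟨D, hD, hβ⟩ hCα hCβ
    obtain rfl : C = D := by
      by_contra hne
      exact hCβ (by rw [hβ]; exact Or.inr ⟨hCα, hne⟩)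
    have e : α = σ := Subtype.ext (α.2.eq_of_minimal h σ.2 hCα hC
      (minimal_of_eq_flip α.2 β.2 hCα hβ) (minimal_of_eq_flip σ.2 τ.2 hC hτ))
    exact ⟨e, Subtype.ext (by rw [hβ, hτ, e])⟩
  suffices ∀ β, Relation.ReflTransGen ((cutGraph 𝓔 x₀).deleteEdges {s(σ, τ)}).Adj σ β → C ∈ β.1 from
    this τ hcon
  intro β hβ
  induction hβ with
  | refl => exact hC
  | tail _ hbc ih =>
    by_contra hn
    rw [SimpleGraph.deleteEdges_adj] at hbc
    obtain ⟨rfl, rfl⟩ := key _ _ hbc.1 ih hn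
    exact hbc.2 rfl

end CutTree

section TreeAction

open Pointwise

variable {G : Type*} [Group G] {A : Set G} {K : ℕ} {σ : Set (Set G)} {C D : Set G}

theorem ne_empty_of_mem_optCuts (hC : C ∈ optCuts (cayleyAdj A) K) : C ≠ ∅ := by
  rintro rfl
  obtain ⟨p, q, h⟩ := hC
  exact Ultrafilter.empty_notMem h.1.1

theorem ne_univ_of_mem_optCuts (hC : C ∈ optCuts (cayleyAdj A) K) : C ≠ Set.univ := by
  rintro rfl
  obtain ⟨p, q, h⟩ := hC
  exact h.1.2.1 Filter.univ_mem

theorem optCuts_subset_connCuts (hgen : Subgroup.closure A = ⊤) :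
    optCuts (cayleyAdj A) K ⊆ connCuts (cayleyAdj A) K :=
  optCuts_subset_minCuts.trans
    (minCuts_subset_connCuts (cayleyAdj_symm A) (connectedSet_cayleyAdj hgen))

theorem isNestedSystem_optCuts (hgen : Subgroup.closure A = ⊤) (K : ℕ) :
    IsNestedSystem (optCuts (cayleyAdj A) K) where
  compl_mem := fun _ hC => compl_mem_optCuts (cayleyAdj_symm A) hC
  not_cross := fun _ hC _ hD =>
    not_cross_of_mem_optCuts (cayleyAdj_symm A) (connectedSet_cayleyAdj hgen) hC hD
  empty_notMem := fun h => ne_empty_of_mem_optCuts h rfl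
  finite_separating := fun x y => (finite_connCuts_separating K (cayleyAdj_symm A)
    (connectedSet_cayleyAdj hgen) x y).subset fun _ hC =>
      ⟨optCuts_subset_connCuts hgen hC.1, hC.2⟩

theorem IsOrientation.smul (hgen : Subgroup.closure A = ⊤)
    (hσ : IsOrientation (optCuts (cayleyAdj A) K) 1 σ) (g : G) :
    IsOrientation (optCuts (cayleyAdj A) K) 1 (g • σ) where
  subset := by
    rintro _ ⟨C, hC, rfl⟩
    exact smul_mem_optCuts (hσ.subset hC) g
  compl_notMem_iff := fun C hC => by
    rw [Set.mem_smul_set_iff_inv_smul_mem, Set.mem_smul_set_iff_inv_smul_mem, Set.smul_set_compl]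
    exact hσ.compl_notMem_iff _ (smul_mem_optCuts hC _)
  mem_of_subset := fun C hC D hD hCD => by
    rw [Set.mem_smul_set_iff_inv_smul_mem] at hC ⊢
    exact hσ.mem_of_subset _ hC _ (smul_mem_optCuts hD _) (Set.smul_set_mono hCD)
  finite := by
    refine (((hσ.finite.image (g • ·))).union
      ((isNestedSystem_optCuts hgen K).finite_separating g 1)).subset ?_
    rintro _ ⟨⟨C, hC, rfl⟩, h1⟩
    by_cases h : (1 : G) ∈ C
    · exact Or.inr ⟨smul_mem_optCuts (hσ.subset hC) g, ⟨1, h, by simp⟩, h1⟩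
    · exact Or.inl ⟨C, ⟨hC, h⟩, rfl⟩

/-- The action of a group on the orientations of its optimal cuts. -/
abbrev orientationMulAction (hgen : Subgroup.closure A = ⊤) (K : ℕ) :
    MulAction G {σ // IsOrientation (optCuts (cayleyAdj A) K) 1 σ} where
  smul g σ := ⟨g • σ.1, σ.2.smul hgen g⟩
  one_smul σ := Subtype.ext (one_smul G σ.1)
  mul_smul g h σ := Subtype.ext (mul_smul g h σ.1)

theorem IsOrientation.finite_diff_of_smul_eq (hgen : Subgroup.closure A = ⊤)
    (hσ : IsOrientation (optCuts (cayleyAdj A) K) 1 σ) (hC : C ∈ σ) :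
    {g | g • σ = σ ∧ g ∉ C}.Finite := by
  have hC' := hσ.subset hC
  have hfin : {g : G | g • C ∈ σ ∧ 1 ∉ g • C}.Finite := by
    refine (hσ.finite.biUnion (t := fun D => {g : G | g • C = D}) fun D hD =>
      finite_transporter (A := A)
      (edgeBoundary_nonempty (connectedSet_cayleyAdj hgen) (ne_empty_of_mem_optCuts hC')
        (ne_univ_of_mem_optCuts hC'))
      (Set.finite_of_encard_le_coe (optCuts_subset_connCuts hgen (hσ.subset hD.1)).2.2)).subset ?_
    intro g hg
    simp only [Set.mem_iUnion]
    exact ⟨g • C, hg, rfl⟩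
  refine (hfin.image (·⁻¹)).subset fun g hg => ⟨g⁻¹, ⟨?_, fun h => hg.2 ?_⟩, inv_inv g⟩
  · have e : g⁻¹ • σ = σ := by rw [inv_smul_eq_iff, hg.1]
    rw [← e]
    exact Set.smul_mem_smul_set hC
  · simpa [Set.mem_smul_set_iff_inv_smul_mem] using h

theorem exists_mem_optCuts_of_splitting {H : Set G}
    (hK : (edgeBoundary (cayleyAdj A) C).encard ≤ K) (h1 : (H ∩ C).Infinite)
    (h2 : (H \ C).Infinite) :
    ∃ D ∈ optCuts (cayleyAdj A) K, (H ∩ D).Infinite ∧ (H \ D).Infinite := by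
  have key : ∀ S : Set G, S.Infinite → ∃ p : Ultrafilter G, S ∈ p ∧ ∀ T ∈ p, T.Infinite := by
    intro S hS
    have := hS.cofinite_inf_principal_neBot
    have hle := Ultrafilter.of_le (Filter.cofinite ⊓ Filter.principal S)
    refine ⟨Ultrafilter.of (Filter.cofinite ⊓ Filter.principal S),
      (hle.trans inf_le_right) (Filter.mem_principal_self S), fun T hT hfin => ?_⟩
    have := (hle.trans inf_le_left) hfin.compl_mem_cofinite
    exact Ultrafilter.compl_mem_iff_notMem.1 this hT
  obtain ⟨p, hp, hp'⟩ := key _ h1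
  obtain ⟨q, hq, hq'⟩ := key _ h2
  obtain ⟨D, hD⟩ := exists_isOptCut (E := cayleyAdj A) (p := p) (q := q) hK
    (Filter.mem_of_superset hp Set.inter_subset_right) (fun h => by
      have := Filter.inter_mem h hq
      exact Ultrafilter.empty_notMem (Filter.mem_of_superset this fun x hx => hx.2.2 hx.1))
  refine ⟨D, ⟨p, q, hD⟩, hp' _ ?_, hq' _ ?_⟩
  · exact Filter.inter_mem (Filter.mem_of_superset hp Set.inter_subset_left) hD.1.1
  · exact Filter.inter_mem (Filter.mem_of_superset hq Set.sdiff_subset)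
      (Ultrafilter.compl_mem_iff_notMem.2 hD.1.2.1)

/-- A group whose discrete triangles are uniformly thin acts on a tree with uniformly bounded
vertex stabilizers. -/
theorem exists_tree_action.{u} {G : Type u} [Group G] {A : Set G} (hA : A.Finite)
    (hgen : Subgroup.closure A = ⊤) {m : ℕ} (hm : HasTriangleMesh A m) :
    ∃ (V : Type u) (_ : MulAction G V) (Γ : SimpleGraph V), Γ.IsTree ∧
      (∀ (g : G) (u v : V), Γ.Adj u v → Γ.Adj (g • u) (g • v)) ∧
      ∃ N : ℕ, N ≠ 0 ∧ ∀ v : V, Nat.card (MulAction.stabilizer G v) ∣ N := by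
  obtain ⟨K, hK⟩ := exists_splitting_cut hA hgen hm
  have hN := isNestedSystem_optCuts hgen K
  let _ := orientationMulAction hgen K
  refine ⟨_, orientationMulAction hgen K, cutGraph (optCuts (cayleyAdj A) K) 1,
    hN.cutGraph_isTree, ?_, ?_⟩
  · rintro g σ τ ⟨C, hC, h⟩
    refine ⟨g • C, Set.smul_mem_smul_set hC, ?_⟩
    change g • τ.1 = insert (g • C)ᶜ (g • σ.1 \ {g • C})
    rw [h, Set.insert_eq, Set.insert_eq, Set.smul_set_union, Set.smul_set_sdiff]
    simp [Set.smul_set_compl]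
  have hstab : ∀ σ : {σ // IsOrientation (optCuts (cayleyAdj A) K) 1 σ},
      Nat.card (MulAction.stabilizer G σ) ≠ 0 := by
    intro σ
    suffices (MulAction.stabilizer G σ : Set G).Finite by
      have := this.to_subtype
      exact Nat.card_pos.ne'
    by_contra hinf
    obtain ⟨C, hC, h1, h2⟩ := hK _ hinf
    obtain ⟨D, hD, h3, h4⟩ := exists_mem_optCuts_of_splitting hC h1 h2
    have key : ∀ g ∈ MulAction.stabilizer G σ, g • σ.1 = σ.1 :=
      fun g hg => congrArg Subtype.val (MulAction.mem_stabilizer_iff.1 hg)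
    by_cases h : D ∈ σ.1
    · exact h4 ((σ.2.finite_diff_of_smul_eq hgen h).subset fun g hg => ⟨key g hg.1, hg.2⟩)
    · exact h3 ((σ.2.finite_diff_of_smul_eq hgen (σ.2.compl_mem hD h)).subset
        fun g hg => ⟨key g hg.1, not_not.2 hg.2⟩)
  let o : {σ // IsOrientation (optCuts (cayleyAdj A) K) 1 σ} := ⟨_, hN.isOrientation_toward 1 1⟩
  have hfin : {σ : {σ // IsOrientation (optCuts (cayleyAdj A) K) 1 σ} |
      σ = o ∨ ∃ C ∈ rootedCuts A K, C ∈ σ.1 ∧ ∀ D ∈ σ.1, D ⊆ C → D = C}.Finite := by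
    refine ((Set.finite_singleton o).union ((finite_rootedCuts (K := K) hA hgen).biUnion
      (t := fun C =>
      {σ : {σ // IsOrientation (optCuts (cayleyAdj A) K) 1 σ} |
        C ∈ σ.1 ∧ ∀ D ∈ σ.1, D ⊆ C → D = C}) ?_)).subset ?_
    · refine fun C _ => Set.Subsingleton.finite fun σ hσ τ hτ => ?_
      exact Subtype.ext (σ.2.eq_of_minimal hN τ.2 hσ.1 hτ.1 hσ.2 hτ.2)
    · rintro σ (h | ⟨C, hC, h⟩)
      · exact Or.inl h
      · right
        simp only [Set.mem_iUnion]
        exact ⟨C, hC, h⟩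
  refine ⟨∏ σ ∈ hfin.toFinset, Nat.card (MulAction.stabilizer G σ),
    Finset.prod_ne_zero_iff.2 fun σ _ => hstab σ, fun σ => ?_⟩
  by_cases hσ : σ = o
  · exact Finset.dvd_prod_of_mem _ (hfin.mem_toFinset.2 (Or.inl hσ))
  obtain ⟨C, hC, -, hmin⟩ := σ.2.exists_minimal_of_ne o.2 fun h => hσ (Subtype.ext h)
  have hC' := σ.2.subset hC
  obtain ⟨g, hg⟩ := exists_smul_mem_rootedCuts hgen (optCuts_subset_connCuts hgen hC')
    (ne_empty_of_mem_optCuts hC') (ne_univ_of_mem_optCuts hC')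
  have hmem : g • σ ∈ hfin.toFinset := by
    refine hfin.mem_toFinset.2 (Or.inr ⟨g • C, hg, Set.smul_mem_smul_set hC, ?_⟩)
    intro D hD hDC
    obtain ⟨F, hF, rfl⟩ : D ∈ g • σ.1 := hD
    simp only [Set.smul_set_subset_smul_set_iff] at hDC
    simp only [hmin F hF hDC]
  have := Finset.dvd_prod_of_mem (fun σ => Nat.card (MulAction.stabilizer G σ)) hmem
  rwa [MulAction.stabilizer_smul_eq_stabilizer_map_conj,
    Subgroup.card_map_of_injective (MulEquiv.injective _)] at this

end TreeAction

section TreePotential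

variable {V : Type*} {Γ : SimpleGraph V} {L : Type*} [Group L]

theorem potential_eq_mul_prod {τ : V → V → L} {f : V → L}
    (hf : ∀ u v, Γ.Adj u v → f v = f u * τ u v) {u v : V} (p : Γ.Walk u v) :
    f v = f u * (p.darts.map fun d => τ d.fst d.snd).prod := by
  induction p with
  | nil => simp
  | cons h p ih => rw [ih, hf _ _ h]; simp [mul_assoc]

/-- Labels of the oriented edges of a tree are the increments of a function on the vertices. -/
theorem SimpleGraph.IsTree.exists_potential (hΓ : Γ.IsTree) (τ : V → V → L)
    (hτ : ∀ u v, Γ.Adj u v → τ u v * τ v u = 1) :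
    ∃ f : V → L, ∀ u v, Γ.Adj u v → f v = f u * τ u v := by
  obtain ⟨r⟩ := hΓ.connected.nonempty
  choose P hP using fun v => (hΓ.existsUnique_path r v).exists
  let f : V → L := fun v => ((P v).darts.map fun d => τ d.fst d.snd).prod
  have key : ∀ u v, Γ.Adj u v → u ∈ (P v).support → f v = f u * τ u v := by
    intro u v h hu
    simp only [f]
    rw [hΓ.isAcyclic.path_concat (hP u) (hP v) h hu, SimpleGraph.Walk.darts_concat]
    simp
  refine ⟨f, fun u v h => ?_⟩
  by_cases hu : u ∈ (P v).support
  · exact key u v h hu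
  · have hv := hΓ.isAcyclic.mem_support_of_ne_mem_support_of_adj_of_isPath (hP u) (hP v) h hu
    rw [key v u h.symm hv, mul_assoc, hτ v u h.symm, mul_one]

/-- A cocycle of a group acting on a tree, together with compatible edge labels, gives rise to a
homomorphism. -/
theorem SimpleGraph.IsTree.exists_hom_of_cocycle {G : Type*} [Group G] [MulAction G V]
    (hΓ : Γ.IsTree) (hG : ∀ (g : G) (u v : V), Γ.Adj u v → Γ.Adj (g • u) (g • v)) {τ : V → V → L}
    (hτ : ∀ u v, Γ.Adj u v → τ u v * τ v u = 1) {β : G → V → L}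
    (hβ : ∀ g h v, β (g * h) v = β g (h • v) * β h v)
    (hτβ : ∀ g u v, Γ.Adj u v → τ (g • u) (g • v) = β g u * τ u v * (β g v)⁻¹) :
    ∃ (f : V → L) (Φ : G →* L), (∀ u v, Γ.Adj u v → f v = f u * τ u v) ∧
      ∀ g v, Φ g = f (g • v) * β g v * (f v)⁻¹ := by
  obtain ⟨f, hf⟩ := hΓ.exists_potential τ hτ
  obtain ⟨r⟩ := hΓ.connected.nonempty
  have hconst : ∀ g v, f (g • v) * β g v * (f v)⁻¹ = f (g • r) * β g r * (f r)⁻¹ := by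
    intro g v
    have hr := (hΓ.connected.preconnected r v)
    rw [SimpleGraph.reachable_iff_reflTransGen] at hr
    induction hr with
    | refl => rfl
    | @tail b c _ h ih =>
      rw [← ih, hf _ _ h, hf _ _ (hG g _ _ h), hτβ g _ _ h]
      group
  refine ⟨f, MonoidHom.mk' (fun g => f (g • r) * β g r * (f r)⁻¹) fun g h => ?_, hf,
    fun g v => (hconst g v).symm⟩
  rw [← hconst g (h • r), hβ, mul_smul]
  group

end TreePotential

section FreeActionOnTree

variable {V : Type*} {Γ : SimpleGraph V} {G : Type*} [Group G] [MulAction G V]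

theorem MulAction.exists_orbit_representatives (G Y : Type*) [Group G] [MulAction G Y] :
    ∃ (r : Y → Y) (s : Y → G), (∀ y, s y • r y = y) ∧ ∀ (g : G) y, r (g • y) = r y := by
  let S := MulAction.orbitRel G Y
  have h : ∀ y : Y, ∃ g : G, g • (Quotient.mk S y).out = y := by
    intro y
    obtain ⟨g, hg⟩ := MulAction.orbitRel_apply.1 (Setoid.symm (Quotient.mk_out (s := S) y))
    exact ⟨g, hg⟩
  choose s hs using h
  refine ⟨_, s, hs, fun g y => ?_⟩
  have : Quotient.mk S (g • y) = Quotient.mk S y :=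
    Quotient.sound (MulAction.orbitRel_apply.2 ⟨g, rfl⟩)
  simp only [this]

/-- A group acting on a tree preserves a two-colouring of the tree up to a homomorphism to a group
of order two. -/
theorem SimpleGraph.IsTree.exists_coloring (hΓ : Γ.IsTree)
    (hG : ∀ (g : G) (u v : V), Γ.Adj u v → Γ.Adj (g • u) (g • v)) :
    ∃ (B : Set V) (χ : G →* Multiplicative (ZMod 2)),
      (∀ u v, Γ.Adj u v → (u ∈ B ↔ v ∉ B)) ∧ ∀ g v, χ g = 1 → (g • v ∈ B ↔ v ∈ B) := by
  obtain ⟨c, χ, hc, hχ⟩ := hΓ.exists_hom_of_cocycle hG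
    (τ := fun _ _ => Multiplicative.ofAdd (1 : ZMod 2)) (β := fun _ _ => 1)
    (fun _ _ _ => by decide) (by simp) (by simp)
  refine ⟨{v | c v = 1}, χ, fun u v h => ?_, fun g v hg => ?_⟩
  · have key : ∀ a b : Multiplicative (ZMod 2), b = a * Multiplicative.ofAdd 1 →
        (a = 1 ↔ b ≠ 1) := by decide
    exact key _ _ (hc u v h)
  · have : c (g • v) = c v := by
      rw [hχ g v] at hg
      simpa [mul_inv_eq_one] using hg
    simp only [Set.mem_ofPred_eq, this]

/-- A group acting freely on a tree, preserving a proper two-colouring, is free. -/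
theorem isFreeGroup_of_free_action (hΓ : Γ.IsTree)
    (hG : ∀ (g : G) (u v : V), Γ.Adj u v → Γ.Adj (g • u) (g • v)) {B : Set V}
    (hB : ∀ u v, Γ.Adj u v → (u ∈ B ↔ v ∉ B)) (hBG : ∀ (g : G) v, g • v ∈ B ↔ v ∈ B)
    (hfree : ∀ (g : G) (v : V), g • v = v → g = 1) : IsFreeGroup G := by
  classical
  let S := MulAction.orbitRel G (V × V)
  have hS : ∀ (g : G) u v, Quotient.mk S (g • u, g • v) = Quotient.mk S (u, v) := fun g u v =>
    Quotient.sound (MulAction.orbitRel_apply.2 ⟨g, rfl⟩)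
  let ℓ : V → V → Quotient S × Bool := fun u v =>
    if u ∈ B then (Quotient.mk S (u, v), true) else (Quotient.mk S (v, u), false)
  obtain ⟨f, Ψ, hf, hΨ⟩ := hΓ.exists_hom_of_cocycle hG (τ := fun u v => FreeGroup.mk [ℓ u v])
    (β := fun _ _ => 1) (by
      intro u v h
      have := hB u v h
      by_cases hu : u ∈ B
      · have hv : v ∉ B := this.1 hu
        simp only [ℓ, hu, hv, if_true, if_false]
        exact mul_inv_cancel (FreeGroup.of (Quotient.mk S (u, v)))
      · have hv : v ∈ B := by tauto
        simp only [ℓ, hu, hv, if_true, if_false]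
        exact inv_mul_cancel (FreeGroup.of (Quotient.mk S (v, u)))) (by simp) (by
      intro g u v _
      simp [ℓ, hS, hBG])
  have hred : ∀ {u v : V} (p : Γ.Walk u v), p.IsPath →
      FreeGroup.IsReduced (p.darts.map fun d => ℓ d.fst d.snd) := by
    intro u v p hp
    have h1 := (hΓ.isAcyclic.isPath_iff_isChain p).1 hp
    rw [SimpleGraph.Walk.edges, List.isChain_map] at h1
    rw [FreeGroup.IsReduced, List.isChain_map]
    have h2 := p.isChain_dartAdj_darts
    rw [List.isChain_iff_getElem] at h1 h2 ⊢
    intro i hi hℓ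
    refine (h1 i hi ?_).elim
    have hadj := h2 i hi
    revert hadj hℓ
    generalize p.darts[i] = d
    generalize p.darts[i + 1] = e
    obtain ⟨⟨a, b⟩, hab⟩ := d
    obtain ⟨⟨b', c⟩, hbc⟩ := e
    rintro hℓ rfl
    change (ℓ a b).1 = (ℓ b c).1 at hℓ
    have hac : ∀ g : G, g • b = b → g • c = a → a = c := by
      intro g hg hgc
      rw [hfree g b hg, one_smul] at hgc
      exact hgc.symm
    suffices a = c by
      subst this
      exact Sym2.eq_swap
    have hb := hB a b hab
    by_cases ha : a ∈ B
    · have hb : b ∉ B := hb.1 ha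
      simp only [ℓ, ha, hb, if_true, if_false] at hℓ
      obtain ⟨g, hg⟩ := MulAction.orbitRel_apply.1 (Quotient.exact hℓ)
      exact hac g (congrArg Prod.snd hg) (congrArg Prod.fst hg)
    · have hb : b ∈ B := by tauto
      simp only [ℓ, ha, hb, if_true, if_false] at hℓ
      obtain ⟨g, hg⟩ := MulAction.orbitRel_apply.1 (Quotient.exact hℓ)
      exact hac g (congrArg Prod.fst hg) (congrArg Prod.snd hg)
  have hinj : Function.Injective Ψ := by
    rw [injective_iff_map_eq_one]
    intro g hg
    obtain ⟨r⟩ := hΓ.connected.nonempty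
    obtain ⟨p, hp, -⟩ := hΓ.existsUnique_path r (g • r)
    refine hfree g r ?_
    have h1 := potential_eq_mul_prod hf p
    rw [hΨ g r, mul_one, mul_inv_eq_one] at hg
    rw [hg, left_eq_mul] at h1
    have h2 : ∀ l : List Γ.Dart, (l.map fun d => FreeGroup.mk [ℓ d.fst d.snd]).prod =
        FreeGroup.mk (l.map fun d => ℓ d.fst d.snd) := by
      intro l
      induction l with
      | nil => rfl
      | cons d l ih => rw [List.map_cons, List.prod_cons, ih, FreeGroup.mul_mk]; rfl
    rw [h2, ← FreeGroup.toWord_eq_nil_iff, FreeGroup.toWord_mk, (hred p hp).reduce_eq,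
      List.map_eq_nil_iff, SimpleGraph.Walk.darts_eq_nil] at h1
    exact h1.eq.symm
  exact IsFreeGroup.ofMulEquiv (MonoidHom.ofInjective hinj).symm

end FreeActionOnTree

section FreePermutations

theorem exists_free_hom_perm {P : Type*} [Group P] {N : ℕ} (hN : N ≠ 0) (hP : Nat.card P ∣ N) :
    ∃ a : P →* Equiv.Perm (Fin N), ∀ p x, a p x = x → p = 1 := by
  obtain ⟨k, hk⟩ := hP
  have : Finite P := Nat.finite_of_card_ne_zero fun h => hN (by rw [hk, h, zero_mul])
  obtain ⟨e⟩ : Nonempty (P × Fin k ≃ Fin N) := by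
    refine Finite.card_eq.1 ?_
    simp [hk]
  refine ⟨e.permCongrHom.toMonoidHom.comp (MonoidHom.mk' (fun p =>
    (Equiv.mulLeft p).prodCongr (Equiv.refl (Fin k))) fun p q => ?_), fun p x h => ?_⟩
  · ext x <;> simp [mul_assoc]
  · have h' := congrArg e.symm h
    simp only [MonoidHom.coe_comp, Function.comp_apply, MulEquiv.toMonoidHom_eq_coe,
      MonoidHom.coe_coe, MonoidHom.mk'_apply, Equiv.permCongrHom_coe, Equiv.permCongr_apply,
      Equiv.symm_apply_apply] at h'
    have := congrArg Prod.fst h'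
    simpa using this

theorem exists_equivariant_equiv {P X : Type*} [Group P] (a : P →* Equiv.Perm X)
    (ha : ∀ p x, a p x = x → p = 1) :
    ∃ (Ω : Set X) (e : P × Ω ≃ X), ∀ p q ω, e (p * q, ω) = a p (e (q, ω)) := by
  let _ := MulAction.compHom X a
  obtain ⟨r, s, hs, hr⟩ := MulAction.exists_orbit_representatives P X
  have hrr : ∀ x, r (r x) = r x := fun x => by
    conv_rhs => rw [← hs x, hr]
  refine ⟨Set.range r, Equiv.ofBijective (fun y => a y.1 y.2) ⟨?_, fun x => ?_⟩, fun p q ω => ?_⟩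
  · rintro ⟨p, ⟨_, x, rfl⟩⟩ ⟨q, ⟨_, y, rfl⟩⟩ h
    change p • r x = q • r y at h
    have hxy : r x = r y := by
      rw [← hrr x, ← hr p, h, hr, hrr]
    have : q⁻¹ * p = 1 := by
      refine ha _ (r x) ?_
      change (q⁻¹ * p) • r x = r x
      rw [mul_smul, h, inv_smul_smul, hxy]
    obtain rfl := (inv_mul_eq_one.1 this)
    simp [hxy]
  · exact ⟨(s x, ⟨r x, x, rfl⟩), hs x⟩
  · change a (p * q) ω = a p (a q ω)
    rw [map_mul]
    rfl

/-- Two free actions of a group on a finite set are isomorphic. -/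
theorem exists_intertwiner {P X : Type*} [Group P] [Finite X] [Nonempty X]
    {a b : P →* Equiv.Perm X} (ha : ∀ p x, a p x = x → p = 1) (hb : ∀ p x, b p x = x → p = 1) :
    ∃ T : Equiv.Perm X, ∀ p, a p * T = T * b p := by
  obtain ⟨Ω, e, he⟩ := exists_equivariant_equiv a ha
  obtain ⟨Ω', e', he'⟩ := exists_equivariant_equiv b hb
  have hP : Nat.card P ≠ 0 := by
    intro h
    have := Nat.card_congr e
    rw [Nat.card_prod, h, zero_mul] at this
    exact Nat.card_pos.ne this
  obtain ⟨ρ⟩ : Nonempty (Ω' ≃ Ω) := by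
    refine Finite.card_eq.1 ?_
    have h1 := (Nat.card_congr e).trans (Nat.card_congr e').symm
    rw [Nat.card_prod, Nat.card_prod] at h1
    exact (Nat.eq_of_mul_eq_mul_left (Nat.pos_of_ne_zero hP) h1).symm
  refine ⟨(e'.symm.trans ((Equiv.refl P).prodCongr ρ)).trans e, fun p => ?_⟩
  ext x
  obtain ⟨⟨q, ω⟩, rfl⟩ := e'.surjective x
  simp [← he, ← he']

end FreePermutations

section FiniteStabilizers

variable {V : Type*} {Γ : SimpleGraph V} {G : Type*} [Group G] [MulAction G V]

theorem exists_free_cocycle {N : ℕ} (hN : N ≠ 0)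
    (hstab : ∀ v : V, Nat.card (MulAction.stabilizer G v) ∣ N) :
    ∃ β : G → V → Equiv.Perm (Fin N), (∀ g h v, β (g * h) v = β g (h • v) * β h v) ∧
      ∀ g v, g • v = v → ∀ x, β g v x = x → g = 1 := by
  classical
  choose a ha using fun v : V => exists_free_hom_perm hN (hstab v)
  let ψ : V → G → Equiv.Perm (Fin N) := fun v g =>
    if h : g • v = v then a v ⟨g, h⟩ else 1
  have hψ : ∀ v g h, g • v = v → h • v = v → ψ v (g * h) = ψ v g * ψ v h := by
    intro v g h hg hh
    have hgh : (g * h) • v = v := by rw [mul_smul, hh, hg]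
    simp only [ψ, hg, hh, hgh, dif_pos]
    rw [← map_mul]
    rfl
  have hψ' : ∀ v g, g • v = v → ∀ x, ψ v g x = x → g = 1 := by
    intro v g hg x hx
    simp only [ψ, hg, dif_pos] at hx
    exact congrArg Subtype.val (ha v _ x hx)
  obtain ⟨r, s, hs, hr⟩ := MulAction.exists_orbit_representatives G V
  have hs' : ∀ g v, ((s (g • v))⁻¹ * g * s v) • r v = r v := by
    intro g v
    rw [mul_smul, mul_smul, hs, inv_smul_eq_iff, ← hr g v, hs]
  refine ⟨fun g v => ψ (r v) ((s (g • v))⁻¹ * g * s v), fun g h v => ?_, fun g v hg x hx => ?_⟩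
  · beta_reduce
    rw [hr, ← hψ _ _ _ _ (hs' h v)]
    · congr 1
      rw [mul_smul]
      group
    · have := hs' g (h • v)
      rwa [hr] at this
  · have := hψ' _ _ (hs' g v) x hx
    rw [hg] at this
    simpa [mul_assoc, inv_mul_eq_one] using this

theorem exists_equivariant_labels {N : ℕ} (hN : N ≠ 0) {β : G → V → Equiv.Perm (Fin N)}
    (hβ : ∀ g h v, β (g * h) v = β g (h • v) * β h v)
    (hfree : ∀ g v, g • v = v → ∀ x, β g v x = x → g = 1) :
    ∃ τ : V → V → Equiv.Perm (Fin N),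
      ∀ g u v, τ (g • u) (g • v) = β g u * τ u v * (β g v)⁻¹ := by
  have : Nonempty (Fin N) := ⟨⟨0, Nat.pos_of_ne_zero hN⟩⟩
  have h0 : ∀ u v : V, ∃ T : Equiv.Perm (Fin N), ∀ g : G, g • u = u → g • v = v →
      β g u * T = T * β g v := by
    intro u v
    let P := MulAction.stabilizer G (u, v)
    have hP : ∀ g : P, g.1 • u = u ∧ g.1 • v = v := fun g =>
      Prod.ext_iff.1 (MulAction.mem_stabilizer_iff.1 g.2)
    obtain ⟨T, hT⟩ := exists_intertwiner
      (a := MonoidHom.mk' (fun g : P => β g u) fun g h => by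
        simp only [Subgroup.coe_mul, hβ, (hP h).1])
      (b := MonoidHom.mk' (fun g : P => β g v) fun g h => by
        simp only [Subgroup.coe_mul, hβ, (hP h).2])
      (fun g x h => Subtype.ext (hfree _ _ (hP g).1 x h))
      (fun g x h => Subtype.ext (hfree _ _ (hP g).2 x h))
    exact ⟨T, fun g hu hv => hT ⟨g, Prod.ext hu hv⟩⟩
  choose T hT using h0
  obtain ⟨r, s, hs, hr⟩ := MulAction.exists_orbit_representatives G (V × V)
  refine ⟨fun u v => β (s (u, v)) (r (u, v)).1 * T (r (u, v)).1 (r (u, v)).2 *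
    (β (s (u, v)) (r (u, v)).2)⁻¹, fun g u v => ?_⟩
  have hr' : r (g • u, g • v) = r (u, v) := hr g (u, v)
  have hs1 := hs (u, v)
  have hs2 : s (g • u, g • v) • r (u, v) = (g • u, g • v) := hr' ▸ hs (g • u, g • v)
  beta_reduce
  rw [hr']
  revert hs1 hs2
  generalize s (g • u, g • v) = t'
  generalize s (u, v) = t
  generalize r (u, v) = y
  obtain ⟨u₀, v₀⟩ := y
  rintro h1 h2
  obtain ⟨rfl, rfl⟩ := Prod.ext_iff.1 h1
  obtain ⟨h3, h4⟩ := Prod.ext_iff.1 h2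
  simp only [Prod.smul_fst, Prod.smul_snd] at h3 h4 ⊢
  obtain ⟨k, hk⟩ : ∃ k, t' * k = g * t := ⟨t'⁻¹ * (g * t), by group⟩
  have hk' : k = t'⁻¹ * (g * t) := by rw [← hk]; group
  have hu : k • u₀ = u₀ := by rw [hk', mul_smul, inv_smul_eq_iff, h3, mul_smul]
  have hv : k • v₀ = v₀ := by rw [hk', mul_smul, inv_smul_eq_iff, h4, mul_smul]
  have e1 : β g (t • u₀) * β t u₀ = β t' u₀ * β k u₀ := by
    rw [← hβ, ← hk, hβ, hu]
  have e2 : β g (t • v₀) * β t v₀ = β t' v₀ * β k v₀ := by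
    rw [← hβ, ← hk, hβ, hv]
  calc β t' u₀ * T u₀ v₀ * (β t' v₀)⁻¹
      = β t' u₀ * (T u₀ v₀ * β k v₀) * (β t' v₀ * β k v₀)⁻¹ := by group
    _ = (β t' u₀ * β k u₀) * T u₀ v₀ * (β t' v₀ * β k v₀)⁻¹ := by rw [← hT _ _ k hu hv]; group
    _ = _ := by rw [← e1, ← e2]; group

/-- A group acting on a tree, with vertex stabilizers of bounded order and preserving a proper
two-colouring, has a subgroup of finite index acting freely. -/
theorem exists_finiteIndex_free_action (hΓ : Γ.IsTree)
    (hG : ∀ (g : G) (u v : V), Γ.Adj u v → Γ.Adj (g • u) (g • v)) {B : Set V}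
    (hB : ∀ u v, Γ.Adj u v → (u ∈ B ↔ v ∉ B)) (hBG : ∀ (g : G) v, g • v ∈ B ↔ v ∈ B)
    {N : ℕ} (hN : N ≠ 0) (hstab : ∀ v : V, Nat.card (MulAction.stabilizer G v) ∣ N) :
    ∃ K : Subgroup G, K.FiniteIndex ∧ ∀ g ∈ K, ∀ v : V, g • v = v → g = 1 := by
  classical
  obtain ⟨β, hβ, hfree⟩ := exists_free_cocycle hN hstab
  obtain ⟨τ, hτ⟩ := exists_equivariant_labels hN hβ hfree
  obtain ⟨f, Φ, -, hΦ⟩ := hΓ.exists_hom_of_cocycle hG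
    (τ := fun u v => if u ∈ B then τ u v else (τ v u)⁻¹) (β := β) (by
      intro u v h
      have := hB u v h
      by_cases hu : u ∈ B
      · have hv : v ∉ B := this.1 hu
        simp [hu, hv]
      · have hv : v ∈ B := by tauto
        simp [hu, hv]) hβ (by
      intro g u v _
      by_cases hu : u ∈ B
      · simp [hu, hBG, hτ]
      · simp [hu, hBG, hτ, mul_assoc])
  refine ⟨Φ.ker, inferInstance, fun g hg v hv => hfree g v hv ⟨0, Nat.pos_of_ne_zero hN⟩ ?_⟩
  rw [MonoidHom.mem_ker, hΦ g v, hv, mul_inv_eq_one, mul_eq_left] at hg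
  rw [hg]
  rfl

/-- A group acting on a tree with vertex stabilizers of bounded order is virtually free. -/
theorem virtuallyFree_of_tree_action (hΓ : Γ.IsTree)
    (hG : ∀ (g : G) (u v : V), Γ.Adj u v → Γ.Adj (g • u) (g • v))
    {N : ℕ} (hN : N ≠ 0) (hstab : ∀ v : V, Nat.card (MulAction.stabilizer G v) ∣ N) :
    VirtuallyFree G := by
  obtain ⟨B, χ, hB, hχ⟩ := hΓ.exists_coloring hG
  have hBG : ∀ (g : χ.ker) v, g • v ∈ B ↔ v ∈ B := fun g v => hχ g v g.2
  have hG' : ∀ (g : χ.ker) (u v : V), Γ.Adj u v → Γ.Adj (g • u) (g • v) := fun g => hG g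
  obtain ⟨K, hK, hfree⟩ := exists_finiteIndex_free_action hΓ hG' hB hBG hN fun v => by
    refine dvd_trans ?_ (hstab v)
    exact Subgroup.card_dvd_of_injective
      ((χ.ker.subtype.comp (MulAction.stabilizer χ.ker v).subtype).codRestrict
        (MulAction.stabilizer G v) fun g => g.2)
      fun g h hgh => Subtype.ext (Subtype.ext (congrArg Subtype.val hgh :))
  have hKfree : IsFreeGroup K := isFreeGroup_of_free_action hΓ (fun g => hG' g) hB
    (fun g => hBG g) fun g v h => Subtype.ext (hfree g g.2 v h)
  refine ⟨K.map χ.ker.subtype, ?_, ?_⟩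
  · refine ⟨?_⟩
    rw [Subgroup.index_map_subtype]
    exact mul_ne_zero hK.index_ne_zero Subgroup.FiniteIndex.index_ne_zero
  · exact IsFreeGroup.ofMulEquiv (K.equivMapOfInjective _ χ.ker.subtype_injective)

end FiniteStabilizers

theorem List.exists_longest_common_prefix {α : Type*} (l₁ l₂ : List α) :
    ∃ m, m <+: l₁ ∧ m <+: l₂ ∧ ∀ a, ¬ (m ++ [a] <+: l₁ ∧ m ++ [a] <+: l₂) := by
  induction l₁ generalizing l₂ with
  | nil => exact ⟨[], by simp⟩
  | cons b l₁ ih =>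
    cases l₂ with
    | nil => exact ⟨[], by simp⟩
    | cons c l₂ =>
      by_cases h : b = c
      · subst h
        obtain ⟨m, h1, h2, h3⟩ := ih l₂
        exact ⟨b :: m, by simpa using h1, by simpa using h2, fun a => by simpa using h3 a⟩
      · refine ⟨[], by simp, by simp, fun a => ?_⟩
        rw [List.nil_append, List.cons_prefix_cons, List.cons_prefix_cons]
        exact fun hc => h (hc.1.1.symm.trans hc.2.1)

theorem exists_lt_not_iff_succ {B : ℕ → Prop} {n : ℕ} (h : ¬ (B 0 ↔ B n)) :
    ∃ i < n, ¬ (B i ↔ B (i + 1)) := by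
  by_contra! hc
  refine h ?_
  clear h
  induction n with
  | zero => rfl
  | succ n ih => exact (ih fun i hi => hc i (by omega)).trans (hc n (by omega))

section FreeGroupPaths

variable {S : Type*} [DecidableEq S]

namespace FreeGroup

theorem toWord_mul_mk_singleton (x : FreeGroup S) (a : S × Bool) :
    (x * mk [a]).toWord = x.toWord ++ [a] ∨
      x.toWord = (x * mk [a]).toWord ++ [(a.1, !a.2)] := by
  by_cases h : IsReduced (x.toWord ++ [a])
  · left
    conv_lhs => rw [← mk_toWord (x := x), mul_mk, toWord_mk, h.reduce_eq]
  · right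
    obtain hx | ⟨l, b, hx⟩ := x.toWord.eq_nil_or_concat
    · simp [hx] at h
    · have hl : IsReduced (l ++ [b]) := by
        rw [← List.concat_eq_append, ← hx]
        exact isReduced_toWord
      have hb : b = (a.1, !a.2) := by
        by_contra hb
        refine h ?_
        rw [hx, List.concat_eq_append]
        refine IsReduced.append_overlap hl ?_ (by simp)
        simp
        rcases a with ⟨a, _ | _⟩ <;> rcases b with ⟨b, _ | _⟩ <;> simp_all
      have : x * mk [a] = mk l := by
        conv_lhs => rw [← mk_toWord (x := x), hx, hb, List.concat_eq_append, ← mul_mk]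
        rw [mul_assoc, mul_mk]
        have : (mk ([(a.1, !a.2)] ++ [a]) : FreeGroup S) = 1 := by
          have := Quot.sound (Red.Step.not_rev (L₁ := []) (L₂ := []) (x := a.1) (b := a.2))
          exact this
        rw [this, mul_one]
      rw [this, toWord_mk, (hl.infix (List.infix_append' [] l [b])).reduce_eq, hx, hb,
        List.concat_eq_append]

theorem exists_prefix_of_exit {m : List (S × Bool)} {a : S × Bool} (L : List (S × Bool)) :
    ∀ x : FreeGroup S, m ++ [a] <+: x.toWord → ¬ m ++ [a] <+: (x * mk L).toWord →
      ∃ L', L' <+: L ∧ x * mk L' = mk m := by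
  induction L with
  | nil =>
    intro x h1 h2
    rw [← one_eq_mk, mul_one] at h2
    exact absurd h1 h2
  | cons b L ih =>
    intro x h1 h2
    have hL : x * mk (b :: L) = x * mk [b] * mk L := by
      rw [mul_assoc, mul_mk]; rfl
    by_cases h : m ++ [a] <+: (x * mk [b]).toWord
    · obtain ⟨L', h3, h4⟩ := ih _ h (hL ▸ h2)
      refine ⟨b :: L', by simpa using h3, ?_⟩
      rw [← h4, mul_assoc, mul_mk]; rfl
    · refine ⟨[b], by simp, ?_⟩
      obtain h3 | h3 := toWord_mul_mk_singleton x b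
      · exact absurd (h1.trans (h3 ▸ List.prefix_append _ _)) h
      · rw [h3, List.prefix_concat_iff] at h1
        obtain h1 | h1 := h1
        · rw [← mk_toWord (x := x * mk [b]), (List.append_inj' h1 rfl).1]
        · exact absurd h1 h

/-- A coarse path in a free group passes near every vertex of the geodesic joining its
endpoints. -/
theorem exists_near_of_branching {F : Set (FreeGroup S)} (hF1 : 1 ∈ F)
    (hF : ∀ s ∈ F, s⁻¹ ∈ F) {n : ℕ} {h : ℕ → FreeGroup S} (hh : ∀ i < n, (h i)⁻¹ * h (i + 1) ∈ F)
    {m : List (S × Bool)} (hm : m <+: (h 0).toWord ∨ m <+: (h n).toWord)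
    (hmax : ∀ a, ¬ (m ++ [a] <+: (h 0).toWord ∧ m ++ [a] <+: (h n).toWord)) :
    ∃ i ≤ n, ∃ s ∈ F, ∃ L, L <+: s.toWord ∧ h i * mk L = mk m := by
  have key : ∀ l, m <+: l → l = m ∨ ∃ a, m ++ [a] <+: l := by
    rintro _ ⟨_ | ⟨a, l⟩, rfl⟩
    · simp
    · exact .inr ⟨a, l, by simp⟩
  have hend : ∀ i ≤ n, (h i).toWord = m →
      ∃ i ≤ n, ∃ s ∈ F, ∃ L, L <+: s.toWord ∧ h i * mk L = mk m := fun i hi he =>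
    ⟨i, hi, 1, hF1, [], by simp, by rw [← one_eq_mk, mul_one, ← he, mk_toWord]⟩
  have hcross : ∀ a, ¬ (m ++ [a] <+: (h 0).toWord ↔ m ++ [a] <+: (h n).toWord) →
      ∃ i ≤ n, ∃ s ∈ F, ∃ L, L <+: s.toWord ∧ h i * mk L = mk m := by
    intro a ha
    obtain ⟨i, hi, hi'⟩ := exists_lt_not_iff_succ (B := fun i => m ++ [a] <+: (h i).toWord) ha
    by_cases hB : m ++ [a] <+: (h i).toWord
    · obtain ⟨L, h1, h2⟩ := exists_prefix_of_exit ((h i)⁻¹ * h (i + 1)).toWord (h i) hB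
        (by rw [mk_toWord, mul_inv_cancel_left]; tauto)
      exact ⟨i, hi.le, _, hh i hi, L, h1, h2⟩
    · obtain ⟨L, h1, h2⟩ := exists_prefix_of_exit (m := m) (a := a)
        ((h i)⁻¹ * h (i + 1))⁻¹.toWord (h (i + 1)) (by tauto) (by rw [mk_toWord]; simpa using hB)
      exact ⟨i + 1, hi, _, hF _ (hh i hi), L, h1, h2⟩
  obtain hm | hm := hm
  · obtain h1 | ⟨a, h1⟩ := key _ hm
    · exact hend 0 (Nat.zero_le n) h1
    · exact hcross a (by have := hmax a; tauto)
  · obtain h1 | ⟨a, h1⟩ := key _ hm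
    · exact hend n le_rfl h1
    · exact hcross a (by have := hmax a; tauto)

end FreeGroup

end FreeGroupPaths

section VirtuallyFreeMesh

open scoped Pointwise

variable {G : Type*} [Group G] {A : Set G}

theorem exists_hasTriangleMesh_of_coarse_retraction (hA : A.Finite)
    (hgen : Subgroup.closure A = ⊤) {S : Type*} {ι : FreeGroup S →* G}
    (hι : Function.Injective ι) {T : Set G} (hT : T.Finite) {φ : G → FreeGroup S}
    (hφ : ∀ g, g⁻¹ * ι (φ g) ∈ T) : ∃ m, HasTriangleMesh A m := by
  classical
  let F : Set (FreeGroup S) := {s | ∃ g g', wordDist A g g' ≤ 1 ∧ (φ g)⁻¹ * φ g' = s}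
  have hF1 : 1 ∈ F := ⟨1, 1, by simp [wordDist_self], by simp⟩
  have hFinv : ∀ s ∈ F, s⁻¹ ∈ F := by
    rintro _ ⟨g, g', h, rfl⟩
    exact ⟨g', g, by rwa [wordDist_comm hgen], by simp⟩
  have hFfin : F.Finite := by
    refine Set.Finite.of_finite_image (f := ι) ?_ hι.injOn
    refine ((hT.inv.mul (finite_wordDist_ball hA hgen 1)).mul hT).subset ?_
    rintro _ ⟨_, ⟨g, g', h, rfl⟩, rfl⟩
    refine ⟨_, ⟨_, Set.inv_mem_inv.2 (hφ g), g⁻¹ * g', ?_, rfl⟩, _, hφ g', ?_⟩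
    · change wordDist A 1 (g⁻¹ * g') ≤ 1
      rwa [← wordDist_eq_one_inv_mul]
    · simp [mul_assoc]
  let P : Set (FreeGroup S) := {p | ∃ s ∈ F, ∃ L, L <+: s.toWord ∧ FreeGroup.mk L = p}
  have hPfin : P.Finite := by
    refine (hFfin.biUnion fun s _ =>
      (List.finite_toSet s.toWord.inits).image FreeGroup.mk).subset ?_
    rintro _ ⟨s, hs, L, hL, rfl⟩
    exact Set.mem_biUnion hs ⟨L, by simpa using hL, rfl⟩
  have hQ : ((T * ι '' P) * (T * ι '' P)⁻¹).Finite :=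
    (hT.mul (hPfin.image ι)).mul (hT.mul (hPfin.image ι)).inv
  obtain ⟨M, hM⟩ := (hQ.image (wordDist A 1)).bddAbove
  refine ⟨M, fun n γ hγ hclose => ?_⟩
  let x := φ (γ 0 0)
  obtain ⟨m, hm1, hm2, hm⟩ := List.exists_longest_common_prefix
    (x⁻¹ * φ (γ 1 0)).toWord (x⁻¹ * φ (γ 2 0)).toWord
  have hnil : ∀ a, ¬ m ++ [a] <+: (x⁻¹ * φ (γ 0 0)).toWord := by simp [x]
  have hsides : ∀ i : Fin 3,
      (m <+: (x⁻¹ * φ (γ i 0)).toWord ∨ m <+: (x⁻¹ * φ (γ (i + 1) 0)).toWord) ∧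
      ∀ a, ¬ (m ++ [a] <+: (x⁻¹ * φ (γ i 0)).toWord ∧
        m ++ [a] <+: (x⁻¹ * φ (γ (i + 1) 0)).toWord) := by
    intro i
    fin_cases i
    · exact ⟨.inr hm1, fun a h => hnil a h.1⟩
    · exact ⟨.inl hm1, hm⟩
    · exact ⟨.inl hm2, fun a h => hnil a h.2⟩
  have hnear : ∀ i, ∃ j ≤ n i, ∃ p ∈ P, φ (γ i j) * p = x * FreeGroup.mk m := by
    intro i
    obtain ⟨j, hj, s, hs, L, hL, he⟩ := FreeGroup.exists_near_of_branching hF1 hFinv (n := n i)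
      (h := fun j => x⁻¹ * φ (γ i j)) (m := m)
      (fun j hj => ⟨_, _, hγ i j hj, by group⟩)
      (by rw [hclose]; exact (hsides i).1) (by rw [hclose]; exact (hsides i).2)
    refine ⟨j, hj, _, ⟨s, hs, L, hL, rfl⟩, ?_⟩
    rw [← he]
    group
  choose u hu p hp he using hnear
  refine ⟨u, hu, fun i j => ?_⟩
  rw [wordDist_eq_one_inv_mul]
  refine hM ⟨_, ?_, rfl⟩
  have hmem : ∀ i, (γ i (u i))⁻¹ * ι (x * FreeGroup.mk m) ∈ T * ι '' P := fun i =>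
    ⟨_, hφ (γ i (u i)), _, ⟨_, hp i, rfl⟩, by rw [← he i, map_mul]; group⟩
  exact ⟨_, hmem i, _, Set.inv_mem_inv.2 (hmem j), by group⟩

theorem VirtuallyFree.exists_hasTriangleMesh (hA : A.Finite) (hgen : Subgroup.closure A = ⊤)
    (hG : VirtuallyFree G) : ∃ m, HasTriangleMesh A m := by
  obtain ⟨H, hH, hfree⟩ := hG
  have hmem : ∀ g : G, g * ((g⁻¹ : G) : G ⧸ H).out ∈ H := fun g => by
    have := QuotientGroup.eq.1 (Quotient.out_eq' ((g⁻¹ : G) : G ⧸ H)).symm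
    simpa using this
  have : Finite (G ⧸ H) := H.finite_quotient_of_finiteIndex
  let e := IsFreeGroup.toFreeGroup H
  refine exists_hasTriangleMesh_of_coarse_retraction hA hgen
    (ι := H.subtype.comp e.symm.toMonoidHom) (T := Set.range (Quotient.out : G ⧸ H → G))
    (φ := fun g => e ⟨_, hmem g⟩) ?_ (Set.finite_range _) fun g => ?_
  · exact H.subtype_injective.comp e.symm.injective
  · exact ⟨((g⁻¹ : G) : G ⧸ H), by simp⟩

end VirtuallyFreeMesh

/-- A group `G` generated by a finite set `A` is virtually free if and only if there
exists `μ ≥ 0` such that every discrete triangle (a closed cycle of three discrete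
paths) has a vertex on each side such that the three chosen vertices are pairwise at
word-metric distance at most `μ`. -/
theorem virtuallyFree_iff_discrete_triangles_mesh {G : Type*} [Group G]
    (A : Set G) (hA : A.Finite) (hgen : Subgroup.closure A = ⊤) :
    VirtuallyFree G ↔
      ∃ μ : ℝ, 0 ≤ μ ∧ ∀ (m : Fin 3 → ℕ) (γ : Fin 3 → ℕ → G),
        (∀ i, IsDiscPath A (γ i) (m i)) →
        (∀ i : Fin 3, γ i (m i) = γ (i + 1) 0) →
        ∃ u : Fin 3 → ℕ, (∀ i, u i ≤ m i) ∧
          ∀ i j, (wordDist A (γ i (u i)) (γ j (u j)) : ℝ) ≤ μ := by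
  constructor
  · intro h
    obtain ⟨M, hM⟩ := h.exists_hasTriangleMesh hA hgen
    exact ⟨M, M.cast_nonneg, fun m γ h1 h2 => by exact_mod_cast hM m γ h1 h2⟩
  · rintro ⟨μ, hμ, h⟩
    have hm : HasTriangleMesh A ⌊μ⌋₊ := fun m γ h1 h2 => by
      obtain ⟨u, hu, hd⟩ := h m γ h1 h2
      exact ⟨u, hu, fun i j => Nat.le_floor (hd i j)⟩
    obtain ⟨V, _, Γ, hΓ, hG, N, hN, hstab⟩ := exists_tree_action hA hgen hm
    exact virtuallyFree_of_tree_action hΓ hG hN hstab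
end

section
/- Let F be a free group with finite basis B and word metric d_B. Then every discrete geodesic polygon in F is 0-thin: for every closed cycle of discrete geodesics γ₀, γ₁, …, γₙ (n ≥ 1, the endpoint of each γᵢ equal to the starting point of γᵢ₊₁, indices modulo n+1), every vertex of γₙ lies among the vertices of γ₀, …, γₙ₋₁. -/
/-- A discrete geodesic polygon: a closed cycle of `n + 1` discrete geodesics
(`n ≥ 1`), the endpoint of each equal to the starting point of the next. -/
structure DiscPolygon (G : Type*) [Group G] (A : Set G) where
  n : ℕ
  one_le_n : 1 ≤ n
  m : ℕ → ℕ
  γ : ℕ → ℕ → G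
  geodesic : ∀ i ≤ n, IsDiscGeodesic A (γ i) (m i)
  chain : ∀ i < n, γ i (m i) = γ (i + 1) 0
  closed : γ n (m n) = γ 0 0

open Classical in
/-- The word metric of the standard basis is computed by the length of reduced words. -/
theorem wordDist_range_of_eq_norm {ι : Type*} (g h : FreeGroup ι) :
    wordDist (Set.range (FreeGroup.of : ι → FreeGroup ι)) g h = (g⁻¹ * h).norm := by
  have hmem : (g⁻¹ * h).norm ∈ { n : ℕ | ∃ l : List (FreeGroup ι), l.length = n ∧
      (∀ x ∈ l, x ∈ Set.range FreeGroup.of ∪ (Set.range FreeGroup.of)⁻¹) ∧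
        l.prod = g⁻¹ * h } := by
    refine ⟨(g⁻¹ * h).toWord.map fun p => FreeGroup.mk [p], by simp [FreeGroup.norm], ?_, ?_⟩
    · simp only [List.mem_map]
      rintro x ⟨⟨a, b⟩, -, rfl⟩
      cases b
      · exact Or.inr ⟨a, by simp [FreeGroup.of, FreeGroup.inv_mk, FreeGroup.invRev]⟩
      · exact Or.inl ⟨a, rfl⟩
    · have key : ∀ L : List (ι × Bool),
          (L.map fun p => FreeGroup.mk [p]).prod = FreeGroup.mk L := by
        intro L
        induction L with
        | nil => rfl
        | cons a L ih => rw [List.map_cons, List.prod_cons, ih, FreeGroup.mul_mk]; rfl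
      rw [key, FreeGroup.mk_toWord]
  refine le_antisymm (Nat.sInf_le hmem) (le_csInf ⟨_, hmem⟩ ?_)
  rintro n ⟨l, rfl, hl, hp⟩
  rw [← hp]
  clear hp
  induction l with
  | nil => simp
  | cons a l ih =>
    rw [List.prod_cons, List.length_cons]
    have h1 : a.norm = 1 := by
      rcases hl a (by simp) with ⟨i, rfl⟩ | ⟨i, hi⟩
      · simp
      · rw [← FreeGroup.norm_inv_eq, ← hi]; simp
    have h2 := ih fun x hx => hl x (by simp [hx])
    have h3 := FreeGroup.norm_mul_le a l.prod
    omega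

open Classical in
/-- Left multiplication by a generator does not change the last letter of a reduced word,
unless one of the two words is trivial. -/
theorem FreeGroup.getLast?_toWord_mul_of_norm_eq_one {ι : Type*} {s y : FreeGroup ι}
    (hs : s.norm = 1) (hy : y ≠ 1) (hsy : s * y ≠ 1) :
    (s * y).toWord.getLast? = y.toWord.getLast? := by
  obtain ⟨a, ha⟩ := List.length_eq_one_iff.mp hs
  rw [Ne, ← FreeGroup.toWord_eq_nil_iff] at hy hsy
  rw [FreeGroup.toWord_mul, ha, List.singleton_append, FreeGroup.reduce.cons,
    FreeGroup.reduce_toWord] at hsy ⊢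
  cases hw : y.toWord with
  | nil => exact absurd hw hy
  | cons b tl =>
    simp only [hw] at hsy ⊢
    split_ifs at hsy ⊢ with hc
    · cases tl with
      | nil => exact absurd rfl hsy
      | cons c tl => rw [List.getLast?_cons_cons]
    · rw [List.getLast?_cons_cons]

open Classical in
/-- If the reduced words of `x` and `y` end in the same letter, there is cancellation
in `x * y⁻¹`. -/
theorem FreeGroup.norm_mul_inv_lt_of_getLast?_eq {ι : Type*} {x y : FreeGroup ι} (hx : x ≠ 1)
    (h : x.toWord.getLast? = y.toWord.getLast?) : (x * y⁻¹).norm < x.norm + y.norm := by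
  have hx' : x.toWord ≠ [] := by rwa [Ne, FreeGroup.toWord_eq_nil_iff]
  have hxl := List.getLast?_eq_some_getLast hx'
  obtain ⟨L, hL⟩ := List.getLast?_eq_some_iff.mp hxl
  obtain ⟨M, hM⟩ := List.getLast?_eq_some_iff.mp (h ▸ hxl)
  generalize x.toWord.getLast hx' = a at hL hM
  have e : x * y⁻¹ = FreeGroup.mk L * (FreeGroup.mk M)⁻¹ := by
    rw [← FreeGroup.mk_toWord (x := x), ← FreeGroup.mk_toWord (x := y), hL, hM,
      ← FreeGroup.mul_mk, ← FreeGroup.mul_mk]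
    group
  have h1 := FreeGroup.norm_mul_le (FreeGroup.mk L) (FreeGroup.mk M)⁻¹
  rw [FreeGroup.norm_inv_eq] at h1
  have h2 := FreeGroup.norm_mk_le (L₁ := L)
  have h3 := FreeGroup.norm_mk_le (L₁ := M)
  have h4 : x.norm = L.length + 1 := by simp [FreeGroup.norm, hL]
  have h5 : y.norm = M.length + 1 := by simp [FreeGroup.norm, hM]
  rw [e]
  omega

open Classical in
/-- Along a path of edges of the Cayley tree avoiding the vertex `p`, the last letter of the
reduced word from the current vertex to `p` is constant. -/
theorem FreeGroup.getLast?_toWord_eq_of_path {ι : Type*} {c : ℕ → FreeGroup ι} {m : ℕ}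
    {p : FreeGroup ι} (hc : ∀ i < m, ((c (i + 1))⁻¹ * c i).norm = 1) (hp : ∀ i ≤ m, c i ≠ p) :
    ∀ i ≤ m, ((c i)⁻¹ * p).toWord.getLast? = ((c 0)⁻¹ * p).toWord.getLast? := by
  have hne : ∀ i ≤ m, (c i)⁻¹ * p ≠ 1 := fun i hi => by
    rw [Ne, inv_mul_eq_one]; exact hp i hi
  intro i hi
  induction i with
  | zero => rfl
  | succ i ih =>
    have e : (c (i + 1))⁻¹ * p = ((c (i + 1))⁻¹ * c i) * ((c i)⁻¹ * p) := by group
    rw [← ih (by omega), e]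
    exact FreeGroup.getLast?_toWord_mul_of_norm_eq_one (hc i hi) (hne i (by omega))
      (e ▸ hne (i + 1) hi)

/-- In a free group with a finite basis, every discrete geodesic polygon (with respect
to the word metric of the basis) is `0`-thin: every vertex of the last side is a
vertex of one of the other sides. -/
theorem freeGroup_discrete_polygons_zero_thin (ι : Type) [Finite ι] :
    ∀ P : DiscPolygon (FreeGroup ι) (Set.range (FreeGroup.of : ι → FreeGroup ι)),
      ∀ t ≤ P.m P.n, ∃ j < P.n, ∃ u ≤ P.m j, P.γ P.n t = P.γ j u := by
  classical
  intro P t ht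
  by_contra! hcon
  have hgeo : ∀ i ≤ P.n, ∀ u ≤ P.m i, ∀ v ≤ P.m i,
      (((P.γ i u)⁻¹ * P.γ i v).norm : ℤ) = |(u : ℤ) - v| := fun i hi u hu v hv => by
    rw [← wordDist_range_of_eq_norm]
    exact P.geodesic i hi u hu v hv
  set p := P.γ P.n t with hpdef
  have hside : ∀ j < P.n, ∀ u ≤ P.m j, ((P.γ j u)⁻¹ * p).toWord.getLast? =
      ((P.γ j 0)⁻¹ * p).toWord.getLast? := fun j hj =>
    FreeGroup.getLast?_toWord_eq_of_path
      (fun i hi => by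
        have := hgeo j hj.le (i + 1) hi i hi.le
        rw [show ((i + 1 : ℕ) : ℤ) - i = 1 by push_cast; ring, abs_one] at this
        exact_mod_cast this)
      fun i hi => (hcon j hj i hi).symm
  have hstart : ∀ j ≤ P.n, ((P.γ j 0)⁻¹ * p).toWord.getLast? =
      ((P.γ 0 0)⁻¹ * p).toWord.getLast? := by
    intro j hj
    induction j with
    | zero => rfl
    | succ j ih => rw [← P.chain j hj, hside j hj _ le_rfl, ih (by omega)]
  have hn := P.one_le_n
  have hne : (P.γ P.n 0)⁻¹ * p ≠ 1 := by
    obtain ⟨k, hk⟩ : ∃ k, P.n = k + 1 := ⟨P.n - 1, by omega⟩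
    have hk' : k < P.n := by omega
    rw [Ne, inv_mul_eq_one, hk, ← P.chain k hk']
    exact (hcon k hk' _ le_rfl).symm
  have hlt := FreeGroup.norm_mul_inv_lt_of_getLast?_eq hne (hstart P.n le_rfl)
  rw [← P.closed, show (P.γ P.n 0)⁻¹ * p * ((P.γ P.n (P.m P.n))⁻¹ * p)⁻¹ =
    (P.γ P.n 0)⁻¹ * P.γ P.n (P.m P.n) by group] at hlt
  have h1 := hgeo P.n le_rfl 0 (Nat.zero_le _) t ht
  have h2 := hgeo P.n le_rfl (P.m P.n) le_rfl t ht
  have h3 := hgeo P.n le_rfl 0 (Nat.zero_le _) (P.m P.n) le_rfl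
  rw [← hpdef] at h1 h2
  rw [abs_of_nonpos (by simp)] at h1 h3
  rw [abs_of_nonneg (by omega)] at h2
  push_cast at h1 h3
  omega
end
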